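/- arXiv:0911.4370 — 5 statements merged into one kernel-verified Lean document; each statement's English description precedes it below -/
import Mathlib

section
/- Let q be an odd prime power and let Ω be a set of q+2 points in PG(2,q) possessing an internal nucleus. If the number of lines of PG(2,q) intersecting Ω equals (q+1)(q+2)/2 + (q−1)/2, then there is a point N ∈ Ω such that Ω \ {N} is the set of projective zeros of a nondegenerate quadratic form on GF(q)³ (an irreducible conic) and N is an external point of this conic (N is not on the conic and lies on two tangent lines of the conic). -/
/-- A point of `PG(2,q)`: a 1-dimensional linear subspace of `F³`. -/
abbrev ProjPoint (F : Type*) [Field F] :=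
  {W : Submodule F (Fin 3 → F) // Module.finrank F W = 1}

/-- A line of `PG(2,q)`: a 2-dimensional linear subspace of `F³`. -/
abbrev ProjLine (F : Type*) [Field F] :=
  {W : Submodule F (Fin 3 → F) // Module.finrank F W = 2}

/-- `P` is an internal nucleus of `Ω` if `P ∈ Ω` and every line through `P`
meets `Ω` in exactly one point other than `P`. -/
def IsInternalNucleus {F : Type*} [Field F] (Ω : Set (ProjPoint F)) (P : ProjPoint F) : Prop :=
  P ∈ Ω ∧ ∀ L : ProjLine F, P.1 ≤ L.1 →
    ∃! Q : ProjPoint F, Q ∈ Ω ∧ Q ≠ P ∧ Q.1 ≤ L.1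

/-- The set of projective zeros of a quadratic form `Q` on `F³`: the points (1-dimensional
subspaces) on which `Q` vanishes identically. -/
def ProjZeros {F : Type*} [Field F] (Q : QuadraticForm F (Fin 3 → F)) : Set (ProjPoint F) :=
  {P : ProjPoint F | ∀ v ∈ P.1, Q v = 0}

/-- A line is tangent to a point set `C` if it meets `C` in exactly one point. -/
def IsTangentLine {F : Type*} [Field F] (C : Set (ProjPoint F)) (L : ProjLine F) : Prop :=
  ∃! P : ProjPoint F, P ∈ C ∧ P.1 ≤ L.1

open Finset in
/-- incidence number of the line with slope `μ` and intercept `c`. -/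
noncomputable def ixN {F : Type*} [Field F] [Fintype F] [DecidableEq F] (f : F → F) (μ c : F) : ℕ :=
  (Finset.univ.filter fun x => f x = μ * x + c).card + if μ = 0 then 1 else 0

set_option linter.unusedSectionVars false

section count
variable {F : Type*} [Field F] [Fintype F] [DecidableEq F] (f : F → F)

lemma ixN_row (μ : F) : ∑ c, ixN f μ c = Fintype.card F + if μ = 0 then Fintype.card F else 0 := by
  unfold ixN
  rw [Finset.sum_add_distrib]
  congr 1
  · have := Finset.card_eq_sum_card_fiberwise (f := fun x => f x - μ * x) (s := (Finset.univ : Finset F))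
      (t := Finset.univ) (by simp)
    rw [Finset.card_univ] at this
    rw [this]
    refine Finset.sum_congr rfl fun c _ => ?_
    congr 1
    ext x
    simp only [Finset.mem_filter, Finset.mem_univ, true_and]
    constructor <;> intro h <;> linear_combination h
  · split_ifs <;> simp

lemma ixN_pencil (x y : F) :
    ∑ μ, ixN f μ (y - μ * x) = Fintype.card F + if f x = y then Fintype.card F else 0 := by
  unfold ixN
  rw [Finset.sum_add_distrib]
  simp only [Finset.card_filter]
  rw [Finset.sum_comm]
  have h1 : ∀ z : F, z ≠ x → (∑ μ : F, if f z = μ * z + (y - μ * x) then 1 else 0) = 1 := by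
    intro z hz
    have hz' : z - x ≠ 0 := sub_ne_zero.2 hz
    rw [← Finset.card_filter, Finset.card_eq_one]
    refine ⟨(f z - y) / (z - x), ?_⟩
    ext μ
    simp only [Finset.mem_filter, Finset.mem_univ, true_and, Finset.mem_singleton]
    rw [eq_div_iff hz']
    constructor <;> intro h <;> linear_combination -h
  rw [← Finset.add_sum_erase _ _ (Finset.mem_univ x)]
  rw [Finset.sum_congr rfl (fun z hz => h1 z (Finset.ne_of_mem_erase hz))]
  have hc : 0 < Fintype.card F := Fintype.card_pos
  have : (∑ μ : F, if f x = μ * x + (y - μ * x) then 1 else 0) = if f x = y then Fintype.card F else 0 := by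
    simp only [add_sub_cancel]
    split_ifs <;> simp
  rw [this]
  simp [Finset.card_erase_of_mem]
  omega

lemma ixN_sum : ∑ μ, ∑ c, ixN f μ c = Fintype.card F ^ 2 + Fintype.card F := by
  simp only [ixN_row, Finset.sum_add_distrib]
  simp [sq]

lemma ixN_sq_sum : ∑ μ, ∑ c, ixN f μ c ^ 2 = 2 * (Fintype.card F ^ 2 + Fintype.card F) := by
  have h : ∀ μ c, ixN f μ c ^ 2 = (∑ x, if c = f x - μ * x then ixN f μ (f x - μ * x) else 0)
      + if μ = 0 then ixN f 0 c else 0 := by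
    intro μ c
    have : ixN f μ c = (∑ x, if c = f x - μ * x then 1 else 0) + if μ = 0 then 1 else 0 := by
      conv_lhs => unfold ixN
      rw [Finset.card_filter]
      congr 1
      refine Finset.sum_congr rfl fun x _ => ?_
      congr 1
      apply propext
      constructor <;> intro h <;> linear_combination -h
    rw [sq]
    nth_rewrite 2 [this]
    rw [mul_add, Finset.mul_sum]
    congr 1
    · refine Finset.sum_congr rfl fun x _ => ?_
      split_ifs with h
      · rw [← h]; simp
      · simp
    · split_ifs with h <;> simp [h]
  simp only [h, Finset.sum_add_distrib]
  have e1 : ∑ μ : F, ∑ c : F, ∑ x, (if c = f x - μ * x then ixN f μ (f x - μ * x) else 0)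
      = ∑ x, ∑ μ, ixN f μ (f x - μ * x) := by
    conv_rhs => rw [Finset.sum_comm]
    refine Finset.sum_congr rfl fun μ _ => ?_
    rw [Finset.sum_comm]
    simp
  rw [e1]
  simp only [ixN_pencil]
  have e2 : ∑ μ : F, ∑ c : F, (if μ = 0 then ixN f 0 c else 0) = ∑ c, ixN f 0 c := by
    rw [Finset.sum_comm]; simp
  rw [e2, ixN_row]
  simp
  ring


/-- the equality hypothesis in affine form -/
def EqHyp {F : Type*} [Field F] [Fintype F] [DecidableEq F] (f : F → F) : Prop :=
  2 * (∑ μ, ∑ c, if ixN f μ c ≠ 0 then (1 : ℤ) else 0) = (Fintype.card F : ℤ) ^ 2 + 2 * Fintype.card F - 1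

lemma weight_bound (h : EqHyp f) (g : ℕ → ℤ) (A B C : ℤ)
    (hg : ∀ i, g i ≤ A * (if i ≠ 0 then 1 else 0) + B * i + C * (i : ℤ) ^ 2) :
    2 * ∑ μ, ∑ c, g (ixN f μ c) ≤ A * ((Fintype.card F : ℤ) ^ 2 + 2 * Fintype.card F - 1)
      + 2 * (B + 2 * C) * ((Fintype.card F : ℤ) ^ 2 + Fintype.card F) := by
  have h1 : ∑ μ, ∑ c, g (ixN f μ c) ≤ ∑ μ, ∑ c, (A * (if ixN f μ c ≠ 0 then 1 else 0)
      + B * (ixN f μ c : ℤ) + C * (ixN f μ c : ℤ) ^ 2) :=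
    Finset.sum_le_sum fun μ _ => Finset.sum_le_sum fun c _ => hg _
  have h2 := ixN_sum f
  have h3 := ixN_sq_sum f
  zify at h2 h3
  simp only [Finset.sum_add_distrib, ← Finset.mul_sum] at h1
  rw [h2, h3] at h1
  have h4 := h
  unfold EqHyp at h4
  rw [← h4]
  linarith

lemma odd_bound (h : EqHyp f) :
    ((Finset.univ.filter fun p : F × F => Odd (ixN f p.1 p.2)).card : ℤ) ≤ 2 * Fintype.card F - 2 := by
  have := weight_bound f h (fun i => if Odd i then 1 else 0) 4 (-4) 1 (by
    intro i
    by_cases hi : i = 0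
    · simp [hi]
    · simp only [hi, ne_eq, not_false_eq_true, if_true]
      split_ifs with ho
      · obtain ⟨k, rfl⟩ := ho
        push_cast
        nlinarith [mul_self_nonneg (2 * (k : ℤ) - 1), sq_nonneg ((k:ℤ)), (by
          rcases k with _ | k
          · simp
          · push_cast; nlinarith [(Nat.cast_nonneg k : (0:ℤ) ≤ k)] : (0:ℤ) ≤ (k:ℤ) * (k - 1))]
      · nlinarith [sq_nonneg ((i : ℤ) - 2)])
  rw [Finset.card_filter, Fintype.sum_prod_type]
  push_cast
  linarith

lemma tangent_bound (h : EqHyp f) :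
    2 * (∑ μ, ∑ c, if ixN f μ c = 1 then (1 : ℤ) else 0) ≤ 3 * Fintype.card F - 3 := by
  have := weight_bound f h (fun i => 2 * if i = 1 then 1 else 0) 6 (-5) 1 (by
    intro i
    rcases i with _ | _ | _ | _ | i
    · simp
    · simp
    · simp
    · simp
    · simp; nlinarith [(Nat.cast_nonneg i : (0:ℤ) ≤ i)])
  simp only [← Finset.mul_sum] at this
  linarith

lemma triple_bound (h : EqHyp f) :
    2 * ((Finset.univ.filter fun p : F × F => 3 ≤ ixN f p.1 p.2).card : ℤ) ≤ Fintype.card F - 1 := by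
  have := weight_bound f h (fun i => 2 * if 3 ≤ i then 1 else 0) 2 (-3) 1 (by
    intro i
    rcases i with _ | _ | _ | _ | i
    · simp
    · simp
    · simp
    · simp
    · simp; nlinarith [(Nat.cast_nonneg i : (0:ℤ) ≤ i)])
  simp only [← Finset.mul_sum] at this
  rw [Finset.card_filter, Fintype.sum_prod_type]
  push_cast
  linarith

/-- a sum of `q` positive numbers equal to `2q` without odd summands is constant `2`. -/
lemma all_two (g : F → ℕ) (hpos : ∀ x, g x ≠ 0) (hev : ∀ x, ¬ Odd (g x))
    (hs : ∑ x, g x = 2 * Fintype.card F) : ∀ x, g x = 2 := by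
  have h2 : ∀ x, 2 ≤ g x := by
    intro x
    have := hpos x
    have := Nat.not_odd_iff_even.1 (hev x)
    obtain ⟨k, hk⟩ := this
    omega
  have : ∑ x : F, 2 = ∑ x, g x := by rw [hs]; simp [mul_comm]
  have := (Finset.sum_eq_sum_iff_of_le (fun x _ => h2 x)).1 this
  intro x
  exact (this x (Finset.mem_univ x)).symm

lemma exists_odd (g : F → ℕ) (hs : Odd (∑ x, g x)) : ∃ x, Odd (g x) := by
  by_contra! hcon
  refine (Nat.not_odd_iff_even.2 ?_) hs
  exact Finset.even_sum _ fun x _ => Nat.not_odd_iff_even.1 (hcon x)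

theorem second_nucleus (hodd : Odd (Fintype.card F)) (h : EqHyp f) :
    (∀ c, ixN f 0 c = 2) ∨ ∃ a, ∀ μ, ixN f μ (f a - μ * a) = 2 := by
  by_contra! hcon
  obtain ⟨hA, hB⟩ := hcon
  have hB : ∀ a, ∃ μ, Odd (ixN f μ (f a - μ * a)) := by
    intro a
    by_contra! h1
    obtain ⟨μ, hμ⟩ := hB a
    refine hμ (all_two (fun μ => ixN f μ (f a - μ * a)) ?_ h1 ?_ μ)
    · intro μ
      have : 0 < (Finset.univ.filter fun x => f x = μ * x + (f a - μ * a)).card :=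
        Finset.card_pos.2 ⟨a, by simp⟩
      simp only [ixN]
      omega
    · rw [ixN_pencil]; simp; ring
  have hA : ∃ c, Odd (ixN f 0 c) := by
    by_contra! h1
    obtain ⟨μ, hμ⟩ := hA
    refine hμ (all_two (fun μ => ixN f 0 μ) ?_ h1 ?_ μ)
    · intro μ
      simp [ixN]
    · rw [ixN_row]; simp; ring
  have hrow : ∀ μ, ∃ c, Odd (ixN f μ c) := by
    intro μ
    by_cases hμ : μ = 0
    · rw [hμ]; exact hA
    · apply exists_odd
      rw [ixN_row]; simpa [hμ] using hodd
  have hpen : ∀ x y, ∃ μ, Odd (ixN f μ (y - μ * x)) := by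
    intro x y
    by_cases hy : f x = y
    · rw [← hy]; exact hB x
    · apply exists_odd (fun μ => ixN f μ (y - μ * x))
      rw [ixN_pencil]; simpa [hy] using hodd
  set O := (Finset.univ.filter fun p : F × F => Odd (ixN f p.1 p.2)) with hO
  obtain ⟨c0, hc0⟩ := hA
  have hbound := odd_bound f h
  have hmem : ((0 : F), c0) ∈ O := by simp [hO, hc0]
  -- the polynomial
  let G : MvPolynomial (Fin 2) F := ∏ p ∈ O.erase (0, c0),
    (1 - MvPolynomial.C p.1 * MvPolynomial.X 0 - MvPolynomial.C (p.2 - c0) * MvPolynomial.X 1)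
  have hcard : (O.erase (0, c0)).card + 1 = O.card := Finset.card_erase_add_one hmem
  have hq1 : 1 < Fintype.card F := Fintype.one_lt_card
  have hdeg : G.totalDegree < (Fintype.card F - 1) * Fintype.card (Fin 2) := by
    have : G.totalDegree ≤ ∑ p ∈ O.erase (0, c0), 1 := by
      refine (MvPolynomial.totalDegree_finsetProd _ _).trans (Finset.sum_le_sum fun p _ => ?_)
      refine (MvPolynomial.totalDegree_sub _ _).trans (max_le ((MvPolynomial.totalDegree_sub _ _).trans (max_le ?_ ?_)) ?_)
      · simp
      · refine (MvPolynomial.totalDegree_mul _ _).trans ?_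
        simp
      · refine (MvPolynomial.totalDegree_mul _ _).trans ?_
        rw [MvPolynomial.totalDegree_C, MvPolynomial.totalDegree_X]
    simp at this
    simp
    rw [← hO] at hbound
    omega
  have hsum := MvPolynomial.sum_eval_eq_zero G hdeg
  have hev : ∀ v : Fin 2 → F, MvPolynomial.eval v G =
      ∏ p ∈ O.erase (0, c0), (1 - p.1 * v 0 - (p.2 - c0) * v 1) := by
    intro v
    simp [G]
  rw [Finset.sum_eq_single (0 : Fin 2 → F)] at hsum
  · rw [hev] at hsum; simp at hsum
  · intro v _ hv
    rw [hev]
    by_cases hz : v 1 = 0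
    · have hx : v 0 ≠ 0 := by
        intro hx; apply hv; ext i; fin_cases i <;> simp [hx, hz]
      obtain ⟨c, hc⟩ := hrow (1 / v 0)
      refine Finset.prod_eq_zero (i := (1 / v 0, c)) ?_ ?_
      · rw [Finset.mem_erase]
        refine ⟨by simp [hx], by simpa [hO] using hc⟩
      · simp [hz, hx]
    · obtain ⟨μ, hμ⟩ := hpen (v 0 / v 1) ((1 + c0 * v 1) / v 1)
      refine Finset.prod_eq_zero (i := (μ, ((1 + c0 * v 1) / v 1) - μ * (v 0 / v 1))) ?_ ?_
      · simp only [hO, Finset.mem_erase, Finset.mem_filter, Finset.mem_univ, hμ, and_true]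
        intro heq
        rw [Prod.mk.injEq] at heq
        obtain ⟨rfl, h2⟩ := heq
        field_simp at h2
        simp at h2
      · field_simp
        ring
  · simp

end count

set_option linter.unusedSectionVars false

section slopes
variable {F : Type*} [Field F] [Fintype F] [DecidableEq F] (f : F → F)

/-- slope of the chord of the graph of `f` -/
def slp {F : Type*} [Field F] (f : F → F) (a x : F) : F := (f x - f a) / (x - a)

lemma slp_comm (a x : F) : slp f a x = slp f x a := by
  unfold slp
  rw [← neg_sub (f a), ← neg_sub a, neg_div_neg_eq]

lemma slp_mul {a x : F} (h : x ≠ a) : slp f a x * (x - a) = f x - f a :=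
  div_mul_cancel₀ _ (sub_ne_zero.2 h)

lemma slp_eq_iff {a x μ : F} (h : x ≠ a) : slp f a x = μ ↔ f x - f a = μ * (x - a) :=
  div_eq_iff (sub_ne_zero.2 h)

lemma slp_ne_zero (hf : Function.Injective f) {a x : F} (h : x ≠ a) : slp f a x ≠ 0 :=
  div_ne_zero (sub_ne_zero.2 fun e => h (hf e)) (sub_ne_zero.2 h)

/-- collinearity -/
lemma slp_col {a b x : F} (hab : b ≠ a) (hxa : x ≠ a) (hxb : x ≠ b) (h : slp f a x = slp f a b) :
    slp f b x = slp f b a := by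
  rw [slp_eq_iff f hxb]
  have h1 := (slp_eq_iff f hxa).1 h
  have h2 := slp_mul f hab
  rw [slp_comm f b a]
  linear_combination h1 + h2

lemma prod_nz : ∏ y ∈ (Finset.univ : Finset F).erase 0, y = -1 := by
  have h1 := congrArg (fun u : Fˣ => (u : F)) (FiniteField.prod_univ_units_id_eq_neg_one (K := F))
  simp only [Units.coe_prod, Units.val_neg, Units.val_one] at h1
  rw [← h1]
  symm
  refine Finset.prod_bij (fun u _ => (u : F)) (by simp) (fun a _ b _ h => Units.ext h) ?_ (by simp)
  intro b hb
  exact ⟨Units.mk0 b (Finset.ne_of_mem_erase hb), by simp, rfl⟩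

lemma prod_shift (g : F → F) (hg : Function.Injective g) (a : F) :
    ∏ x ∈ (Finset.univ : Finset F).erase a, (g x - g a) = -1 := by
  rw [← prod_nz]
  refine Finset.prod_bij (fun x _ => g x - g a) ?_ ?_ ?_ (by simp)
  · intro x hx
    simp only [Finset.mem_erase, Finset.mem_univ, and_true] at hx ⊢
    exact sub_ne_zero.2 fun e => hx (hg e)
  · intro x _ y _ h
    exact hg (by linear_combination h)
  · intro y hy
    obtain ⟨x, hx⟩ := (Finite.injective_iff_surjective.1 hg) (y + g a)
    refine ⟨x, ?_, by simp [hx]⟩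
    simp only [Finset.mem_erase, Finset.mem_univ, and_true] at hy ⊢
    rintro rfl
    apply hy
    linear_combination -hx

lemma prod_slp (hf : Function.Injective f) (a : F) :
    ∏ x ∈ (Finset.univ : Finset F).erase a, slp f a x = 1 := by
  unfold slp
  rw [Finset.prod_div_distrib, prod_shift f hf a, prod_shift (fun x => x) Function.injective_id a]
  norm_num

/-- type one points: exactly one 3-secant (slope `σ`) and one tangent (slope `-σ`). -/
structure TOne (f : F → F) (a σ : F) : Prop where
  ne : σ ≠ 0
  two : ∃ x1 x2, x1 ≠ a ∧ x2 ≠ a ∧ x1 ≠ x2 ∧ slp f a x1 = σ ∧ slp f a x2 = σ ∧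
    ∀ x, x ≠ a → slp f a x = σ → x = x1 ∨ x = x2
  uniq : ∀ x x', x ≠ a → x' ≠ a → x ≠ x' → slp f a x = slp f a x' → slp f a x = σ
  tan : ∀ x, x ≠ a → slp f a x ≠ -σ
  prod : ∀ h : F → F, (∏ x ∈ (Finset.univ : Finset F).erase a, h (slp f a x)) * h (-σ) =
    h σ * ∏ μ ∈ (Finset.univ : Finset F).erase 0, h μ

/-- missed slopes -/
def missed (f : F → F) (a : F) : Finset F :=
  Finset.univ.filter fun μ => μ ≠ 0 ∧ ∀ x, x ≠ a → slp f a x ≠ μ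

lemma missed_eq (hf : Function.Injective f) (a : F) :
    missed f a = (Finset.univ.erase 0) \ ((Finset.univ.erase a).image (slp f a)) := by
  ext μ
  simp [missed]

lemma image_sub (hf : Function.Injective f) (a : F) :
    ((Finset.univ.erase a).image (slp f a)) ⊆ (Finset.univ.erase 0) := by
  intro μ
  simp only [Finset.mem_image, Finset.mem_erase, Finset.mem_univ, and_true]
  rintro ⟨x, hx, rfl⟩
  exact slp_ne_zero f hf hx

lemma missed_card (hf : Function.Injective f) (a : F) :
    (missed f a).card + ((Finset.univ.erase a).image (slp f a)).card = Fintype.card F - 1 := by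
  rw [missed_eq f hf, Finset.card_sdiff_add_card_eq_card (image_sub f hf a)]
  simp [Finset.card_erase_of_mem]

lemma missed_pos (hf : Function.Injective f) (h2 : (2 : F) ≠ 0) (a : F) : 1 ≤ (missed f a).card := by
  by_contra hcon
  have h0 := missed_card f hf a
  have hc : ((Finset.univ.erase a).image (slp f a)).card = (Finset.univ.erase a).card := by
    rw [Finset.card_erase_of_mem (Finset.mem_univ a), Finset.card_univ]; omega
  have he : ((Finset.univ.erase a).image (slp f a)) = Finset.univ.erase 0 := by
    apply Finset.eq_of_subset_of_card_le (image_sub f hf a)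
    rw [hc]; simp [Finset.card_erase_of_mem]
  have hp := Finset.prod_image (f := fun x : F => x) (Finset.card_image_iff.1 hc)
  rw [he, prod_nz] at hp
  rw [prod_slp f hf] at hp
  apply h2
  linear_combination -hp

lemma tOne_of_card (hf : Function.Injective f) (a : F) (hc : (missed f a).card = 1) :
    ∃ σ, TOne f a σ := by
  have h0 := missed_card f hf a
  obtain ⟨τ, hτ⟩ := Finset.card_eq_one.1 hc
  set I := ((Finset.univ.erase a).image (slp f a)) with hI
  have hτm : τ ∈ missed f a := by rw [hτ]; simp
  obtain ⟨hτ0, hτn⟩ : τ ≠ 0 ∧ ∀ x, x ≠ a → slp f a x ≠ τ := by simpa [missed] using hτm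
  have hτI : τ ∉ I := by
    simp only [hI, Finset.mem_image, Finset.mem_erase, Finset.mem_univ, and_true, not_exists, not_and]
    exact hτn
  have hins : insert τ I = Finset.univ.erase 0 := by
    rw [← Finset.sdiff_union_of_subset (image_sub f hf a), ← missed_eq f hf, hτ]
    rfl
  have hdom : (Finset.univ.erase a).card = Fintype.card F - 1 := by
    simp [Finset.card_erase_of_mem]
  obtain ⟨x1, hx1, x2, hx2, h12, he⟩ := Finset.exists_ne_map_eq_of_card_lt_of_maps_to
    (s := Finset.univ.erase a) (t := I) (f := slp f a) (by omega)
    (fun x hx => Finset.mem_coe.2 (Finset.mem_image_of_mem _ hx))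
  have hI2 : ((Finset.univ.erase a).erase x1).image (slp f a) = I := by
    apply Finset.Subset.antisymm
    · exact Finset.image_subset_image (Finset.erase_subset _ _)
    · intro μ hμ
      obtain ⟨x, hx, rfl⟩ := Finset.mem_image.1 hμ
      by_cases hxx : x = x1
      · subst hxx
        rw [he]
        exact Finset.mem_image_of_mem _ (Finset.mem_erase.2 ⟨h12.symm, hx2⟩)
      · exact Finset.mem_image_of_mem _ (Finset.mem_erase.2 ⟨hxx, hx⟩)
  have hinj : Set.InjOn (slp f a) ((Finset.univ.erase a).erase x1 : Finset F) := by
    apply Finset.card_image_iff.1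
    rw [hI2, Finset.card_erase_of_mem hx1]; omega
  have hprod : ∀ h : F → F, (∏ x ∈ (Finset.univ : Finset F).erase a, h (slp f a x)) * h τ =
      h (slp f a x1) * ∏ μ ∈ (Finset.univ : Finset F).erase 0, h μ := by
    intro h
    rw [← Finset.mul_prod_erase _ _ hx1, ← hins, Finset.prod_insert hτI, ← hI2, Finset.prod_image hinj]
    ring
  have hτσ : τ = - slp f a x1 := by
    have := hprod id
    simp only [id] at this
    rw [prod_slp f hf, prod_nz] at this
    linear_combination this
  have hx1' := Finset.ne_of_mem_erase hx1
  have hx2' := Finset.ne_of_mem_erase hx2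
  refine ⟨slp f a x1, slp_ne_zero f hf hx1', ⟨x1, x2, hx1', hx2', h12, rfl, he.symm, ?_⟩, ?_, ?_, ?_⟩
  · intro x hx hxe
    by_cases hxx : x = x1
    · exact Or.inl hxx
    · right
      apply hinj _ _ (hxe.trans he)
      · simp [hx, hxx]
      · simp [hx2', h12.symm]
  · intro x x' hx hx' hne hxe
    by_cases hxx : x = x1
    · rw [hxx]
    by_cases hxx' : x' = x1
    · rw [hxe, hxx']
    exact absurd (hinj (by simp [hx, hxx]) (by simp [hx', hxx']) hxe) hne
  · rw [← hτσ]; exact hτn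
  · rw [← hτσ]; exact hprod

lemma tOne_half {a b σ : F} (ha : TOne f a σ) (hf : Function.Injective f) (hab : b ≠ a)
    (hno : ∀ x, x ≠ a → x ≠ b → slp f a x ≠ slp f a b) :
    (∏ x ∈ (Finset.univ.erase a).erase b, (f x - f a - slp f a b * (x - a))) * (b - a) *
      (σ + slp f a b) * slp f a b = σ - slp f a b := by
  set s := slp f a b with hs
  have hs0 : s ≠ 0 := slp_ne_zero f hf hab
  have hsσ : σ ≠ s := by
    intro e
    obtain ⟨x1, x2, h1, h2, h12, e1, e2, -⟩ := ha.two
    by_cases hb : x1 = b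
    · exact hno x2 h2 (fun h => h12 (hb.trans h.symm)) (e2.trans e)
    · exact hno x1 h1 hb (e1.trans e)
  have hsτ : -σ ≠ s := fun e => ha.tan b hab e.symm
  have hp := ha.prod (fun m => if m = s then 1 else m - s)
  simp only [hsσ, hsτ, if_false] at hp
  have hbm : b ∈ (Finset.univ : Finset F).erase a := by simp [hab]
  rw [← Finset.mul_prod_erase _ _ hbm] at hp
  have hsm : s ∈ (Finset.univ : Finset F).erase 0 := by simp [hs0]
  rw [← Finset.mul_prod_erase _ _ hsm] at hp
  simp only [← hs, if_true, one_mul] at hp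
  have e1 : ∏ x ∈ (Finset.univ.erase a).erase b, (if slp f a x = s then (1 : F) else slp f a x - s) =
      ∏ x ∈ (Finset.univ.erase a).erase b, (slp f a x - s) := by
    refine Finset.prod_congr rfl fun x hx => ?_
    simp only [Finset.mem_erase, Finset.mem_univ, and_true] at hx
    rw [if_neg (hno x hx.2 hx.1)]
  have e2 : ∏ m ∈ (Finset.univ.erase (0 : F)).erase s, (if m = s then (1 : F) else m - s) =
      ∏ m ∈ (Finset.univ.erase 0).erase s, (m - s) := by
    refine Finset.prod_congr rfl fun x hx => ?_
    rw [if_neg (Finset.ne_of_mem_erase hx)]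
  rw [e1, e2] at hp
  have e3 : (0 - s) * ∏ m ∈ (Finset.univ.erase (0 : F)).erase s, (m - s) = -1 := by
    rw [Finset.erase_right_comm, Finset.mul_prod_erase (Finset.univ.erase s) (fun m => m - s)
      (by simp [hs0.symm])]
    exact prod_shift (fun x => x) Function.injective_id s
  have e4 : (b - a) * ∏ x ∈ (Finset.univ.erase a).erase b, (x - a) = -1 := by
    rw [Finset.mul_prod_erase (Finset.univ.erase a) (fun m => m - a) hbm]
    exact prod_shift (fun x => x) Function.injective_id a
  have e5 : (∏ x ∈ (Finset.univ.erase a).erase b, (f x - f a - s * (x - a))) =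
      (∏ x ∈ (Finset.univ.erase a).erase b, (slp f a x - s)) *
      ∏ x ∈ (Finset.univ.erase a).erase b, (x - a) := by
    rw [← Finset.prod_mul_distrib]
    refine Finset.prod_congr rfl fun x hx => ?_
    simp only [Finset.mem_erase, Finset.mem_univ, and_true] at hx
    rw [sub_mul, slp_mul f hx.2]
  rw [e5]
  set W := ∏ x ∈ (Finset.univ.erase a).erase b, (slp f a x - s)
  set V := ∏ x ∈ (Finset.univ.erase a).erase b, (x - a)
  set U := ∏ m ∈ (Finset.univ.erase (0 : F)).erase s, (m - s)
  linear_combination (W * (σ + s) * s) * e4 + s * hp - (σ - s) * e3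

lemma tOne_rel (hf : Function.Injective f) (h2 : (2 : F) ≠ 0) {a b σ ρ : F} (ha : TOne f a σ)
    (hb : TOne f b ρ) (hab : b ≠ a) : slp f a b ^ 2 = σ * ρ := by
  by_cases hno : ∀ x, x ≠ a → x ≠ b → slp f a x ≠ slp f a b
  · have h1 := tOne_half f ha hf hab hno
    have h2' := tOne_half f hb hf hab.symm (by
      intro x hxb hxa h
      exact hno x hxa hxb (slp_col f hab.symm hxb hxa h))
    rw [← slp_comm f a b, Finset.erase_right_comm] at h2'
    have : ∏ x ∈ (Finset.univ.erase a).erase b, (f x - f b - slp f a b * (x - b)) =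
        ∏ x ∈ (Finset.univ.erase a).erase b, (f x - f a - slp f a b * (x - a)) := by
      refine Finset.prod_congr rfl fun x _ => ?_
      linear_combination slp_mul f hab
    rw [this] at h2'
    set s := slp f a b
    set W := ∏ x ∈ (Finset.univ.erase a).erase b, (f x - f a - s * (x - a))
    apply mul_left_cancel₀ h2
    linear_combination (ρ + s) * h1 + (σ + s) * h2'
  · push Not at hno
    obtain ⟨x, hxa, hxb, hx⟩ := hno
    have e1 := ha.uniq x b hxa hab hxb hx
    have e2 := hb.uniq x a hxb hab.symm hxa (slp_col f hab hxa hxb hx)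
    have e3 := slp_col f hab hxa hxb hx
    rw [e1] at hx
    rw [e2, ← slp_comm f a b] at e3
    rw [← hx] at e3
    rw [← hx, e3]; ring
end slopes

section conic
variable {F : Type*} [Field F] [Fintype F] [DecidableEq F] (f : F → F)

lemma ixN_one_of_missed {a μ : F} (h : μ ∈ missed f a) : μ ≠ 0 ∧ ixN f μ (f a - μ * a) = 1 := by
  obtain ⟨h0, h1⟩ : μ ≠ 0 ∧ ∀ x, x ≠ a → slp f a x ≠ μ := by simpa [missed] using h
  refine ⟨h0, ?_⟩
  simp only [ixN, h0, if_false, add_zero]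
  rw [Finset.card_eq_one]
  refine ⟨a, ?_⟩
  ext x
  simp only [Finset.mem_filter, Finset.mem_univ, true_and, Finset.mem_singleton]
  constructor
  · intro hx
    by_contra hxa
    exact h1 x hxa ((slp_eq_iff f hxa).2 (by linear_combination hx))
  · rintro rfl; ring

lemma sum_missed : ((∑ a, (missed f a).card : ℕ) : ℤ) ≤ ∑ μ, ∑ c, if ixN f μ c = 1 then (1 : ℤ) else 0 := by
  have h1 : ∑ μ, ∑ c, (if ixN f μ c = 1 then (1 : ℤ) else 0) =
      (((Finset.univ.filter fun p : F × F => ixN f p.1 p.2 = 1).card : ℕ) : ℤ) := by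
    rw [Finset.card_filter, Fintype.sum_prod_type]
    push_cast
    rfl
  rw [h1, ← Finset.card_sigma]
  norm_cast
  refine Finset.card_le_card_of_injOn (fun p => (p.2, f p.1 - p.2 * p.1)) ?_ ?_
  · rintro ⟨a, μ⟩ h
    simp only [Finset.coe_sigma, Set.mem_sigma_iff, Finset.mem_coe] at h
    simpa using (ixN_one_of_missed f h.2).2
  · rintro ⟨a, μ⟩ h ⟨b, ν⟩ h' he
    simp only [Finset.coe_sigma, Set.mem_sigma_iff, Finset.mem_coe] at h h'
    simp only [Prod.mk.injEq] at he
    obtain ⟨rfl, he⟩ := he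
    by_cases hab : b = a
    · subst hab; rfl
    · exfalso
      have : μ ≠ 0 ∧ ∀ x, x ≠ a → slp f a x ≠ μ := by simpa [missed] using h.2
      refine this.2 b hab ((slp_eq_iff f hab).2 ?_)
      linear_combination -he

/-- many type one points -/
lemma many_tOne (hf : Function.Injective f) (h2 : (2 : F) ≠ 0) (h : EqHyp f) :
    ∃ D : Finset F, ∃ σ : F → F, (∀ a ∈ D, TOne f a (σ a)) ∧ Fintype.card F + 3 ≤ 2 * D.card := by
  set D := Finset.univ.filter fun a => (missed f a).card = 1
  have hD : ∀ a ∈ D, ∃ σ, TOne f a σ := fun a ha => tOne_of_card f hf a (by simpa [D] using ha)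
  choose! σ hσ using hD
  refine ⟨D, σ, hσ, ?_⟩
  have h3 := sum_missed f
  have h4 := tangent_bound f h
  have h5 : ∑ a : F, (if (missed f a).card = 1 then 1 else 2) ≤ ∑ a, (missed f a).card := by
    refine Finset.sum_le_sum fun a _ => ?_
    have := missed_pos f hf h2 a
    split_ifs <;> omega
  have h6 : ∑ a : F, (if (missed f a).card = 1 then 1 else 2) + D.card = 2 * Fintype.card F := by
    rw [Finset.card_filter, ← Finset.sum_add_distrib]
    rw [Finset.sum_congr rfl (g := fun _ => 2) (by intro x _; split_ifs <;> rfl)]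
    simp [mul_comm]
  have hq1 : 1 < Fintype.card F := Fintype.one_lt_card
  omega

/-- a set with two equivalence relations covering all pairs -/
lemma two_equiv {α β γ : Type*} (S : Set α) (p : α → β) (r : α → γ)
    (h : ∀ b ∈ S, ∀ c ∈ S, p b = p c ∨ r b = r c) :
    (∀ b ∈ S, ∀ c ∈ S, p b = p c) ∨ (∀ b ∈ S, ∀ c ∈ S, r b = r c) := by
  by_contra! hcon
  obtain ⟨⟨b, hb, c, hc, h1⟩, ⟨d, hd, e, he, h2⟩⟩ := hcon
  have hbc : r b = r c := (h b hb c hc).resolve_left h1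
  have hde : p d = p e := (h d hd e he).resolve_right h2
  grind

/-- final step: all points are on the conic -/
lemma finish (hf : Function.Injective f) (h2 : (2 : F) ≠ 0) (D : Finset F) (σ : F → F)
    (hD : ∀ a ∈ D, TOne f a (σ a)) (hc : Fintype.card F + 3 ≤ 2 * D.card)
    (n m K : F) (hK : K ≠ 0) (hcon : ∀ b ∈ D, (b - n) * (f b - m) = K)
    (hσ : ∀ b ∈ D, σ b * (b - n) ^ 2 = K) (z : F) (hz : z ≠ n ∨ f z ≠ m) :
    (z - n) * (f z - m) = K := by
  by_contra hne
  set x := z - n with hx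
  set y := f z - m with hy
  have hz' : x ≠ 0 ∨ y ≠ 0 := hz.imp sub_ne_zero.2 sub_ne_zero.2
  set E := D.image (fun b => b - n) with hE
  have hEc : E.card = D.card := Finset.card_image_of_injective _ (sub_left_injective)
  let ι : F → F := fun t => K * (t - x) / (y * t - K)
  have hD0 : ∀ t ∈ E, t ≠ 0 ∧ t ≠ x ∧ y * t - K ≠ 0 ∧ t + n ∈ D ∧ t + n ≠ z ∧ t * (f (t + n) - m) = K := by
    intro t ht
    obtain ⟨b, hb, rfl⟩ := Finset.mem_image.1 ht
    have h1 := hcon b hb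
    have hbz : b ≠ z := by rintro rfl; exact hne h1
    refine ⟨?_, ?_, ?_, by simpa using hb, by simpa using hbz, by simpa using h1⟩
    · intro h0; rw [h0, zero_mul] at h1; exact hK h1.symm
    · intro h0; apply hbz; linear_combination h0
    · intro h0
      apply hbz
      apply hf
      have hb0 : b - n ≠ 0 := by
        intro h0; rw [h0, zero_mul] at h1; exact hK h1.symm
      apply mul_left_cancel₀ hb0
      linear_combination h1 - h0
  have hinj : Set.InjOn ι E := by
    intro t ht u hu h
    have h1 := (hD0 t ht).2.2.1
    have h1' := (hD0 u hu).2.2.1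
    simp only [ι] at h
    rw [div_eq_div_iff h1 h1'] at h
    have : K * (x * y - K) * (t - u) = 0 := by linear_combination h
    rcases mul_eq_zero.1 this with h3 | h3
    · rcases mul_eq_zero.1 h3 with h4 | h4
      · exact absurd h4 hK
      · exact absurd (by linear_combination h4) hne
    · exact sub_eq_zero.1 h3
  have hsub : E ∪ E.image ι ⊆ Finset.univ.erase 0 := by
    intro t ht
    simp only [Finset.mem_erase, Finset.mem_univ, and_true]
    rcases Finset.mem_union.1 ht with h | h
    · exact (hD0 t h).1
    · obtain ⟨u, hu, rfl⟩ := Finset.mem_image.1 h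
      have := hD0 u hu
      exact div_ne_zero (mul_ne_zero hK (sub_ne_zero.2 this.2.1)) this.2.2.1
  have hinter : ∀ t ∈ E ∩ E.image ι, y * t ^ 2 = K * x := by
    intro t ht
    obtain ⟨h1, h3⟩ := Finset.mem_inter.1 ht
    obtain ⟨u, hu, hut⟩ := Finset.mem_image.1 h3
    have dt := hD0 t h1
    have du := hD0 u hu
    have hrel : K * (u - x) = t * (y * u - K) := by
      rw [← hut]; exact (div_mul_cancel₀ _ du.2.2.1).symm
    have hzu : z ≠ u + n := du.2.2.2.2.1.symm
    have hzt : z ≠ t + n := dt.2.2.2.2.1.symm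
    have eu := du.2.2.2.2.2
    have et := dt.2.2.2.2.2
    have hxu : x - u ≠ 0 := sub_ne_zero.2 du.2.1.symm
    have hxt : x - t ≠ 0 := sub_ne_zero.2 dt.2.1.symm
    -- slope from t to z
    have hs : slp f (t + n) z = -K / (t * u) := by
      rw [slp_eq_iff f hzt, div_mul_eq_mul_div, eq_div_iff (mul_ne_zero dt.1 du.1)]
      have e1 : f z = y + m := by rw [hy]; ring
      have e2 : z = x + n := by rw [hx]; ring
      rw [e1]
      linear_combination -hrel - u * et - K * e2
    have hσt := hσ _ dt.2.2.2.1
    simp only [add_sub_cancel_right] at hσt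
    by_cases hut' : u = t
    · exfalso
      apply (hD _ dt.2.2.2.1).tan z hzt
      rw [hs, hut', ← hσt]
      have := dt.1
      field_simp
    · have hs2 : slp f (t + n) (u + n) = -K / (t * u) := by
        rw [slp_eq_iff f (by simpa using hut'), div_mul_eq_mul_div, eq_div_iff (mul_ne_zero dt.1 du.1)]
        linear_combination t * eu - u * et
      have := (hD _ dt.2.2.2.1).uniq z (u + n) hzt (by simpa using hut') hzu (hs.trans hs2.symm)
      rw [hs, div_eq_iff (mul_ne_zero dt.1 du.1)] at this
      have hu' : u = -t := by
        have h5 : K * (t + u) = 0 := by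
          linear_combination (-t) * this - u * hσt
        rcases mul_eq_zero.1 h5 with h6 | h6
        · exact absurd h6 hK
        · linear_combination h6
      rw [hu'] at hrel
      linear_combination hrel
  have hcard : (E ∩ E.image ι).card ≤ 2 := by
    rcases (E ∩ E.image ι).eq_empty_or_nonempty with h | ⟨t, ht⟩
    · simp [h]
    · have : E ∩ E.image ι ⊆ {t, -t} := by
        intro u hu
        have h1 := hinter t ht
        have h3 := hinter u hu
        have hy0 : y ≠ 0 := by
          intro h0
          rw [h0, zero_mul] at h1
          rcases mul_eq_zero.1 h1.symm with h4 | h4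
          · exact hK h4
          · rcases hz' with h5 | h5
            · exact h5 h4
            · exact h5 h0
        have h4 : u ^ 2 = t ^ 2 := mul_left_cancel₀ hy0 (h3.trans h1.symm)
        simpa using sq_eq_sq_iff_eq_or_eq_neg.1 h4
      exact (Finset.card_le_card this).trans Finset.card_le_two
  have h7 := Finset.card_le_card hsub
  have h8 := Finset.card_union_add_card_inter E (E.image ι)
  rw [Finset.card_image_of_injOn hinj] at h8
  rw [Finset.card_erase_of_mem (Finset.mem_univ _), Finset.card_univ] at h7
  omega

theorem conic_of_eq (hf : Function.Injective f) (h2 : (2 : F) ≠ 0) (h : EqHyp f) :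
    ∃ n K : F, K ≠ 0 ∧ ∀ x, x ≠ n → (x - n) * (f x - f n) = K := by
  obtain ⟨D, σ, hD, hc⟩ := many_tOne f hf h2 h
  have hq1 : 1 < Fintype.card F := Fintype.one_lt_card
  obtain ⟨a, ha⟩ : D.Nonempty := Finset.card_pos.1 (by omega)
  set S : Set F := {b | b ∈ D ∧ b ≠ a} with hS
  have hσ0 := (hD a ha).ne
  let r : F → F := fun b => slp f a b / σ a
  have hr : ∀ b, slp f a b = σ a * r b := fun b => by simp only [r]; field_simp
  have hr0 : ∀ b, b ≠ a → r b ≠ 0 := fun b hb => div_ne_zero (slp_ne_zero f hf hb) hσ0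
  have hr1 : ∀ b, b ≠ a → 1 + r b ≠ 0 := by
    intro b hb h0
    apply (hD a ha).tan b hb
    rw [hr]; linear_combination σ a * h0
  have hσr : ∀ b ∈ S, σ b = σ a * r b ^ 2 := by
    intro b hb
    have := tOne_rel f hf h2 (hD a ha) (hD b hb.1) hb.2
    rw [hr] at this
    apply mul_left_cancel₀ hσ0
    linear_combination -this
  have hfb : ∀ b, b ≠ a → f b = f a + σ a * r b * (b - a) := by
    intro b hb
    have := slp_mul f hb
    rw [hr] at this
    linear_combination -this
  have hsgn : ∀ b ∈ S, ∀ c ∈ S, c ≠ b → slp f b c = -(σ a * r b * r c) ∨ slp f b c = σ a * r b * r c := by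
    intro b hb c hc hcb
    have := tOne_rel f hf h2 (hD b hb.1) (hD c hc.1) hcb
    rw [hσr b hb, hσr c hc] at this
    rw [or_comm]
    apply sq_eq_sq_iff_eq_or_eq_neg.1
    rw [this]; ring
  have key := two_equiv S (fun b => r b * (b - a) / (1 + r b)) (fun b => (1 - r b) / (r b * (b - a))) (by
    intro b hb c hc
    by_cases hcb : c = b
    · left; rw [hcb]
    have hb1 := hr1 b hb.2
    have hc1 := hr1 c hc.2
    have hb0 : r b * (b - a) ≠ 0 := mul_ne_zero (hr0 b hb.2) (sub_ne_zero.2 hb.2)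
    have hc0 : r c * (c - a) ≠ 0 := mul_ne_zero (hr0 c hc.2) (sub_ne_zero.2 hc.2)
    have e1 := hfb b hb.2
    have e2 := hfb c hc.2
    refine (hsgn b hb c hc hcb).imp ?_ ?_
    · intro hs
      rw [slp_eq_iff f hcb] at hs
      rw [div_eq_div_iff hb1 hc1]
      apply mul_left_cancel₀ hσ0
      linear_combination -hs + e2 - e1
    · intro hs
      rw [slp_eq_iff f hcb] at hs
      rw [div_eq_div_iff hb0 hc0]
      apply mul_left_cancel₀ hσ0
      linear_combination hs - e2 + e1)
  obtain ⟨b0, hb0D, hb0a⟩ : ∃ b ∈ D, b ≠ a := by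
    apply Finset.exists_mem_ne
    omega
  have hb0 : b0 ∈ S := ⟨hb0D, hb0a⟩
  rcases key with key | key
  · -- main case
    set k := r b0 * (b0 - a) / (1 + r b0) with hk
    have hk0 : k ≠ 0 := div_ne_zero (mul_ne_zero (hr0 b0 hb0a) (sub_ne_zero.2 hb0a)) (hr1 b0 hb0a)
    have hkb : ∀ b ∈ S, r b * (b - a - k) = k := by
      intro b hb
      have := key b hb b0 hb0
      simp only [← hk] at this
      rw [div_eq_iff (hr1 b hb.2)] at this
      linear_combination this
    have hK : σ a * k ^ 2 ≠ 0 := mul_ne_zero hσ0 (pow_ne_zero _ hk0)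
    have fin := finish f hf h2 D σ hD hc (a + k) (f a + σ a * k) (σ a * k ^ 2) hK (by
      intro b hb
      by_cases hba : b = a
      · rw [hba]; ring
      · have e1 := hkb b ⟨hb, hba⟩
        rw [hfb b hba]
        linear_combination (σ a * (b - a) + σ a * k - σ a * k) * e1) (by
      intro b hb
      by_cases hba : b = a
      · rw [hba]; ring
      · have e1 := hkb b ⟨hb, hba⟩
        rw [hσr b ⟨hb, hba⟩]
        linear_combination (σ a * (r b * (b - a - k) + k)) * e1)
    have hfn : f (a + k) = f a + σ a * k := by
      by_contra hne
      have := fin (a + k) (Or.inr hne)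
      rw [sub_self, zero_mul] at this
      exact hK this.symm
    refine ⟨a + k, σ a * k ^ 2, hK, fun x hx => ?_⟩
    rw [hfn]
    exact fin x (Or.inl hx)
  · -- the other case
    have hkb : ∀ b ∈ S, ∀ c ∈ S, (1 - r b) * (r c * (c - a)) = (1 - r c) * (r b * (b - a)) := by
      intro b hb c hc
      have h0 : r b * (b - a) ≠ 0 := mul_ne_zero (hr0 b hb.2) (sub_ne_zero.2 hb.2)
      have h0' : r c * (c - a) ≠ 0 := mul_ne_zero (hr0 c hc.2) (sub_ne_zero.2 hc.2)
      exact (div_eq_div_iff h0 h0').1 (key b hb c hc)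
    have hsl : ∀ b ∈ S, ∀ c ∈ S, c ≠ b → slp f b c = σ a * r b * r c := by
      intro b hb c hc hcb
      rw [slp_eq_iff f hcb, hfb b hb.2, hfb c hc.2]
      linear_combination σ a * hkb b hb c hc
    by_cases hone : ∃ b ∈ S, r b = 1
    · -- all collinear
      obtain ⟨b, hb, hb1⟩ := hone
      have hall : ∀ c ∈ S, r c = 1 := by
        intro c hc
        have := hkb b hb c hc
        rw [hb1] at this
        simp only [sub_self, zero_mul, one_mul] at this
        rcases mul_eq_zero.1 this.symm with h3 | h3
        · linear_combination -h3
        · exact absurd (sub_eq_zero.1 h3) hb.2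
      obtain ⟨x1, x2, -, -, -, -, -, hx⟩ := (hD a ha).two
      have hsub : D ⊆ {a, x1, x2} := by
        intro c hc
        by_cases hca : c = a
        · simp [hca]
        · have := hx c hca (by rw [hr, hall c ⟨hc, hca⟩, mul_one])
          simp only [Finset.mem_insert, Finset.mem_singleton]
          tauto
      have h3 := (Finset.card_le_card hsub).trans Finset.card_le_three
      have hDu : D.card ≤ Fintype.card F := Finset.card_le_univ D
      have hq3 : Fintype.card F = 3 := by omega
      have hDuniv : D = Finset.univ := by
        apply Finset.eq_univ_of_card
        omega
      refine ⟨a, σ a, hσ0, fun x hxa => ?_⟩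
      rw [hfb x hxa, hall x ⟨by rw [hDuniv]; simp, hxa⟩]
      have := FiniteField.pow_card_sub_one_eq_one (x - a) (sub_ne_zero.2 hxa)
      rw [hq3] at this
      have h9 : (x - a) ^ 2 = 1 := this
      linear_combination σ a * h9
    · exfalso
      push Not at hone
      have h3 := triple_bound f h
      have h4 : D.card ≤ (Finset.univ.filter fun p : F × F => 3 ≤ ixN f p.1 p.2).card := by
        refine Finset.card_le_card_of_injOn (fun b => (σ b, f b - σ b * b)) ?_ ?_
        · intro b hb
          obtain ⟨x1, x2, h1, h2', h12, e1, e2, -⟩ := (hD b hb).two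
          simp only [Finset.coe_filter, Finset.mem_univ, true_and, Set.mem_ofPred_eq]
          have : ({b, x1, x2} : Finset F) ⊆ Finset.univ.filter fun x => f x = σ b * x + (f b - σ b * b) := by
            intro x hx
            simp only [Finset.mem_insert, Finset.mem_singleton] at hx
            simp only [Finset.mem_filter, Finset.mem_univ, true_and]
            rcases hx with rfl | rfl | rfl
            · ring
            · linear_combination (slp_eq_iff f h1).1 e1
            · linear_combination (slp_eq_iff f h2').1 e2
          have h5 := Finset.card_le_card this
          rw [Finset.card_eq_three.2 ⟨b, x1, x2, h1.symm, h2'.symm, h12, rfl⟩] at h5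
          unfold ixN
          omega
        · have aux : ∀ b ∈ D, ∀ c ∈ D, c ≠ b → b ≠ a → σ b = σ c → f b - σ b * b = f c - σ c * c → False := by
            intro b hb c hc hcb hba he1 he2
            have hbS : b ∈ S := ⟨hb, hba⟩
            have hs : slp f b c = σ b := by
              rw [slp_eq_iff f hcb, ← he1] at *
              linear_combination -he2
            by_cases hca : c = a
            · rw [hca, slp_comm, hr, he1, hca] at hs
              apply hone b hbS
              apply mul_left_cancel₀ hσ0
              rw [hs, mul_one]
            · have hcS : c ∈ S := ⟨hc, hca⟩
              rw [hsl b hbS c hcS hcb, hσr b hbS] at hs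
              have hrr : r c = r b := by
                apply mul_left_cancel₀ (mul_ne_zero hσ0 (hr0 b hba))
                rw [hs]; ring
              have h6 := hkb b hbS c hcS
              rw [hrr] at h6
              have h7 := mul_left_cancel₀ (sub_ne_zero.2 (hone b hbS).symm) h6
              have h8 := mul_left_cancel₀ (hr0 b hba) h7
              exact hcb (by linear_combination h8)
          intro b hb c hc he
          simp only [Prod.mk.injEq] at he
          by_contra hbc
          by_cases hba : b = a
          · exact aux c hc b hb hbc (fun hca => hbc (hba.trans hca.symm)) he.1.symm he.2.symm
          · exact aux b hb c hc (Ne.symm hbc) hba he.1 he.2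
      omega
end conic

section geom
variable {F : Type*} [Field F]

lemma gen_of_mem (Q : ProjPoint F) {v : Fin 3 → F} (hv : v ∈ Q.1) (h0 : v ≠ 0) :
    Q.1 = Submodule.span F {v} := by
  symm
  apply Submodule.eq_of_le_of_finrank_eq
  · rwa [Submodule.span_singleton_le_iff_mem]
  · rw [finrank_span_singleton h0, Q.2]

lemma exists_gen (Q : ProjPoint F) : ∃ v : Fin 3 → F, v ≠ 0 ∧ Q.1 = Submodule.span F {v} := by
  have : Q.1 ≠ ⊥ := by
    intro h
    have := Q.2
    rw [h, finrank_bot] at this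
    omega
  obtain ⟨v, hv, h0⟩ := Submodule.exists_mem_ne_zero_of_ne_bot this
  exact ⟨v, h0, gen_of_mem Q hv h0⟩

lemma sup_rank {P Q : ProjPoint F} (h : P ≠ Q) : Module.finrank F (P.1 ⊔ Q.1 : Submodule F (Fin 3 → F)) = 2 := by
  have h1 := Submodule.finrank_sup_add_finrank_inf_eq P.1 Q.1
  rw [P.2, Q.2] at h1
  have h2 : P.1 ⊓ Q.1 = ⊥ := by
    by_contra hne
    obtain ⟨v, hv, h0⟩ := Submodule.exists_mem_ne_zero_of_ne_bot hne
    apply h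
    apply Subtype.ext
    rw [gen_of_mem P hv.1 h0, gen_of_mem Q hv.2 h0]
  rw [h2, finrank_bot] at h1
  omega

/-- the line joining two points -/
noncomputable def joinL {P Q : ProjPoint F} (h : P ≠ Q) : ProjLine F := ⟨P.1 ⊔ Q.1, sup_rank h⟩

lemma eq_join {P Q : ProjPoint F} (h : P ≠ Q) (L : ProjLine F) (hP : P.1 ≤ L.1) (hQ : Q.1 ≤ L.1) :
    joinL h = L := by
  apply Subtype.ext
  apply Submodule.eq_of_le_of_finrank_eq
  · exact sup_le hP hQ
  · rw [L.2]; exact sup_rank h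

lemma ker_rank {φ : Module.Dual F (Fin 3 → F)} (h : φ ≠ 0) : Module.finrank F (LinearMap.ker φ) = 2 := by
  have := Module.Dual.finrank_ker_add_one_of_ne_zero h
  simp at this
  exact this

lemma line_ker (L : ProjLine F) : ∃ φ : Module.Dual F (Fin 3 → F), φ ≠ 0 ∧ L.1 = LinearMap.ker φ := by
  have hlt : L.1 < ⊤ := by
    rw [lt_top_iff_ne_top]
    intro h
    have := L.2
    rw [h, finrank_top] at this
    simp at this
  obtain ⟨φ, h0, hφ⟩ := Submodule.exists_le_ker_of_lt_top L.1 hlt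
  refine ⟨φ, h0, Submodule.eq_of_le_of_finrank_eq hφ ?_⟩
  rw [L.2, ker_rank h0]

abbrev Bas (F : Type*) [Field F] := Module.Basis (Fin 3) F (Fin 3 → F)

/-- affine point -/
noncomputable def apt (b : Bas F) (x y : F) : Fin 3 → F := x • b 2 + y • b 1 + b 0

lemma coord_apt (b : Bas F) (x y : F) :
    b.coord 0 (apt b x y) = 1 ∧ b.coord 1 (apt b x y) = y ∧ b.coord 2 (apt b x y) = x := by
  simp [apt]

lemma apt_ne (b : Bas F) (x y : F) : apt b x y ≠ 0 := by
  intro h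
  have := (coord_apt b x y).1
  rw [h] at this
  simp at this

lemma expand (b : Bas F) (v : Fin 3 → F) :
    v = b.coord 2 v • b 2 + b.coord 1 v • b 1 + b.coord 0 v • b 0 := by
  conv_lhs => rw [← b.sum_repr v]
  rw [Fin.sum_univ_three]
  simp only [Module.Basis.coord_apply]
  abel

/-- the functional `Y - μ X - c Z` -/
noncomputable def lfun (b : Bas F) (μ c : F) : Module.Dual F (Fin 3 → F) :=
  b.coord 1 - μ • b.coord 2 - c • b.coord 0

lemma lfun_apt (b : Bas F) (μ c x y : F) : lfun b μ c (apt b x y) = y - μ * x - c := by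
  obtain ⟨h0, h1, h2⟩ := coord_apt b x y
  simp only [lfun, LinearMap.sub_apply, LinearMap.smul_apply, h0, h1, h2]
  simp

lemma lfun_one (b : Bas F) (μ c : F) : lfun b μ c (b 1) = 1 := by
  simp [lfun]

lemma lfun_two (b : Bas F) (μ c : F) : lfun b μ c (b 2) = -μ := by
  simp [lfun]

lemma lfun_zero (b : Bas F) (μ c : F) : lfun b μ c (b 0) = -c := by
  simp [lfun]

lemma lfun_ne (b : Bas F) (μ c : F) : lfun b μ c ≠ 0 := by
  intro h
  have := lfun_one b μ c
  rw [h] at this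
  simp at this

noncomputable def aline (b : Bas F) (p : F × F) : ProjLine F :=
  ⟨LinearMap.ker (lfun b p.1 p.2), ker_rank (lfun_ne b p.1 p.2)⟩

lemma aline_inj (b : Bas F) : Function.Injective (aline b) := by
  rintro ⟨μ, c⟩ ⟨ν, d⟩ h
  have h' : LinearMap.ker (lfun b μ c) = LinearMap.ker (lfun b ν d) := congrArg Subtype.val h
  have key : ∀ v, lfun b μ c v = 0 → lfun b ν d v = 0 := by
    intro v hv
    have : v ∈ LinearMap.ker (lfun b μ c) := hv
    rw [h'] at this
    exact this
  have h1 := key (b 2 + μ • b 1) (by simp [lfun_one, lfun_two])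
  have h2 := key (b 0 + c • b 1) (by simp [lfun_one, lfun_zero])
  simp [lfun_one, lfun_two, lfun_zero] at h1 h2
  ext
  · simp; linear_combination h1
  · simp; linear_combination h2

lemma exists_aline (b : Bas F) (L : ProjLine F) (h : b 1 ∉ L.1) : ∃ p, aline b p = L := by
  obtain ⟨φ, h0, hφ⟩ := line_ker L
  have h1 : φ (b 1) ≠ 0 := by
    rw [hφ] at h; exact h
  refine ⟨(-(φ (b 2) / φ (b 1)), -(φ (b 0) / φ (b 1))), ?_⟩
  apply Subtype.ext
  rw [hφ]
  have : φ = φ (b 1) • lfun b (-(φ (b 2) / φ (b 1))) (-(φ (b 0) / φ (b 1))) := by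
    apply b.ext
    intro i
    fin_cases i
    · simp [lfun_zero]; field_simp
    · simp [lfun_one]
    · simp [lfun_two]; field_simp
  ext v
  simp only [aline, LinearMap.mem_ker]
  have hv : φ v = φ (b 1) * lfun b (-(φ (b 2) / φ (b 1))) (-(φ (b 0) / φ (b 1))) v :=
    congrArg (fun g => g v) this
  rw [hv, mul_eq_zero]
  simp [h1]

/-- coordinates adapted to a set -/
structure Coords (Ω : Set (ProjPoint F)) (P M : ProjPoint F) (b : Bas F) (f : F → F) : Prop where
  hP : P.1 = Submodule.span F {b 1}
  hM : M.1 = Submodule.span F {b 2}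
  mem : ∀ Q : ProjPoint F, Q ∈ Ω ↔ Q = P ∨ Q = M ∨ ∃ x, Q.1 = Submodule.span F {apt b x (f x)}

lemma normalize_pt (b : Bas F) (v : Fin 3 → F) (h : b.coord 0 v ≠ 0) :
    Submodule.span F {v} = Submodule.span F {apt b (b.coord 2 v / b.coord 0 v) (b.coord 1 v / b.coord 0 v)} := by
  have : apt b (b.coord 2 v / b.coord 0 v) (b.coord 1 v / b.coord 0 v) = (b.coord 0 v)⁻¹ • v := by
    have he := congrArg (fun w => (b.coord 0 v)⁻¹ • w) (expand b v)
    rw [he]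
    simp only [apt, smul_add, smul_smul, inv_mul_cancel₀ h, one_smul, div_eq_inv_mul]
  rw [this, Submodule.span_singleton_smul_eq (IsUnit.mk0 _ (inv_ne_zero h))]

lemma exists_coords (Ω : Set (ProjPoint F)) (P M : ProjPoint F) (hnuc : IsInternalNucleus Ω P)
    (hM : M ∈ Ω) (hMP : M ≠ P) : ∃ b f, Coords Ω P M b f := by
  obtain ⟨p, hp0, hp⟩ := exists_gen P
  obtain ⟨m, hm0, hm⟩ := exists_gen M
  have hli : LinearIndependent F ![p, m] := by
    rw [LinearIndependent.pair_iff' hp0]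
    intro a ha
    apply hMP
    apply Subtype.ext
    rw [hm]
    symm
    apply gen_of_mem P _ hm0
    rw [hp, ← ha]
    exact Submodule.smul_mem _ _ (Submodule.mem_span_singleton_self _)
  obtain ⟨w, hw⟩ := exists_linearIndependent_cons_of_lt_finrank hli (by simp)
  let b : Bas F := basisOfLinearIndependentOfCardEqFinrank hw (by simp)
  have hb : ∀ i, b i = (Fin.cons w ![p, m] : Fin 3 → (Fin 3 → F)) i := by
    intro i; simp [b]
  have hb1 : b 1 = p := hb 1
  have hb2 : b 2 = m := hb 2
  have hφ : ∀ x : F, b.coord 2 - x • b.coord 0 ≠ 0 := by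
    intro x h
    have := congrArg (fun g => g (b 2)) h
    simp at this
  have hφ0 : b.coord 0 ≠ 0 := by
    intro h
    have := congrArg (fun g => g (b 0)) h
    simp at this
  have key : ∀ x, ∃ y, ∃ Q ∈ Ω, Q.1 = Submodule.span F {apt b x y} ∧
      ∀ R ∈ Ω, R ≠ P → R.1 ≤ LinearMap.ker (b.coord 2 - x • b.coord 0) → R = Q := by
    intro x
    obtain ⟨Q, ⟨hQ, hQP, hQL⟩, hu⟩ := hnuc.2 ⟨_, ker_rank (hφ x)⟩ (by
      rw [hp, ← hb1, Submodule.span_singleton_le_iff_mem]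
      simp)
    obtain ⟨v, hv0, hv⟩ := exists_gen Q
    simp only [hv, Submodule.span_singleton_le_iff_mem, LinearMap.mem_ker, LinearMap.sub_apply,
      LinearMap.smul_apply, smul_eq_mul] at hQL
    have hz : b.coord 0 v ≠ 0 := by
      intro hz
      rw [hz, mul_zero, sub_zero] at hQL
      have h1 := expand b v
      rw [hz, hQL] at h1
      simp only [zero_smul, zero_add, add_zero] at h1
      apply hQP
      apply Subtype.ext
      rw [hv]
      symm
      apply gen_of_mem P _ hv0
      rw [hp, h1, ← hb1]
      exact Submodule.smul_mem _ _ (Submodule.mem_span_singleton_self _)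
    refine ⟨b.coord 1 v / b.coord 0 v, Q, hQ, ?_, fun R hR hRP hRL => hu R ⟨hR, hRP, hRL⟩⟩
    rw [hv, normalize_pt b v hz]
    congr 4
    rw [div_eq_iff hz]
    linear_combination hQL
  choose f Qf hQf hf hfu using key
  refine ⟨b, f, by rw [hp, hb1], by rw [hm, hb2], fun Q => ⟨fun hQ => ?_, ?_⟩⟩
  · by_cases hQP : Q = P
    · exact Or.inl hQP
    right
    obtain ⟨v, hv0, hv⟩ := exists_gen Q
    by_cases hz : b.coord 0 v = 0
    · left
      have hu := fun A B => @ExistsUnique.unique _ _ (hnuc.2 ⟨_, ker_rank hφ0⟩ (by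
        rw [hp, ← hb1, Submodule.span_singleton_le_iff_mem]
        simp)) A B
      apply hu Q M ⟨hQ, hQP, ?_⟩ ⟨hM, hMP, ?_⟩
      · rw [hv, Submodule.span_singleton_le_iff_mem]; exact hz
      · rw [hm, ← hb2, Submodule.span_singleton_le_iff_mem]
        simp
    · right
      refine ⟨b.coord 2 v / b.coord 0 v, ?_⟩
      rw [← hf]
      congr 1
      apply hfu _ Q hQ hQP
      rw [hv, Submodule.span_singleton_le_iff_mem, LinearMap.mem_ker, LinearMap.sub_apply,
        LinearMap.smul_apply, smul_eq_mul, div_mul_cancel₀ _ hz, sub_self]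
  · rintro (rfl | rfl | ⟨x, hx⟩)
    · exact hnuc.1
    · exact hM
    · have : Q = Qf x := Subtype.ext (hx.trans (hf x).symm)
      rw [this]; exact hQf x
end geom

section geom2
variable {F : Type*} [Field F]

lemma nuc_unique {Ω : Set (ProjPoint F)} {P : ProjPoint F} (hn : IsInternalNucleus Ω P)
    (L : ProjLine F) (hL : P.1 ≤ L.1) {Q R : ProjPoint F} (hQ : Q ∈ Ω) (hQP : Q ≠ P)
    (hQL : Q.1 ≤ L.1) (hR : R ∈ Ω) (hRP : R ≠ P) (hRL : R.1 ≤ L.1) : Q = R :=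
  (hn.2 L hL).unique ⟨hQ, hQP, hQL⟩ ⟨hR, hRP, hRL⟩

/-- affine point as a projective point -/
noncomputable def appt (b : Bas F) (x y : F) : ProjPoint F :=
  ⟨Submodule.span F {apt b x y}, finrank_span_singleton (apt_ne b x y)⟩

lemma appt_inj (b : Bas F) {x y x' y' : F} (h : appt b x y = appt b x' y') : x = x' ∧ y = y' := by
  have h1 : apt b x y ∈ Submodule.span F {apt b x' y'} := by
    have : (appt b x y).1 = (appt b x' y').1 := congrArg Subtype.val h
    have h2 : Submodule.span F {apt b x y} = Submodule.span F {apt b x' y'} := this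
    rw [← h2]; exact Submodule.mem_span_singleton_self _
  obtain ⟨a, ha⟩ := Submodule.mem_span_singleton.1 h1
  obtain ⟨h0, h1, h2⟩ := coord_apt b x y
  obtain ⟨h0', h1', h2'⟩ := coord_apt b x' y'
  rw [← ha] at h0 h1 h2
  simp only [map_smul, h0', h1', h2', smul_eq_mul] at h0 h1 h2
  have : a = 1 := by simpa using h0
  subst this
  simp at h1 h2
  exact ⟨h2.symm, h1.symm⟩

lemma appt_le_aline (b : Bas F) (x y : F) (p : F × F) :
    (appt b x y).1 ≤ (aline b p).1 ↔ y = p.1 * x + p.2 := by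
  have : (appt b x y).1 ≤ (aline b p).1 ↔ lfun b p.1 p.2 (apt b x y) = 0 := by
    simp only [appt, aline, Submodule.span_singleton_le_iff_mem, LinearMap.mem_ker]
  rw [this, lfun_apt]
  constructor
  · intro h; linear_combination h
  · intro h; linear_combination h

namespace Coords
variable {Ω : Set (ProjPoint F)} {P M : ProjPoint F} {b : Bas F} {f : F → F}

lemma P_not_le (c : Coords Ω P M b f) (p : F × F) : ¬ P.1 ≤ (aline b p).1 := by
  rw [c.hP, Submodule.span_singleton_le_iff_mem]
  simp only [aline, LinearMap.mem_ker, lfun_one]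
  exact one_ne_zero

lemma M_le (c : Coords Ω P M b f) (p : F × F) : M.1 ≤ (aline b p).1 ↔ p.1 = 0 := by
  rw [c.hM, Submodule.span_singleton_le_iff_mem]
  simp only [aline, LinearMap.mem_ker, lfun_two, neg_eq_zero]

lemma mem' (c : Coords Ω P M b f) (Q : ProjPoint F) :
    Q ∈ Ω ↔ Q = P ∨ Q = M ∨ ∃ x, Q = appt b x (f x) := by
  rw [c.mem]
  have : ∀ x, Q.1 = Submodule.span F {apt b x (f x)} ↔ Q = appt b x (f x) := by
    intro x
    rw [Subtype.ext_iff, appt]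
  simp only [this]

lemma exists_line (c : Coords Ω P M b f) (L : ProjLine F) (h : ¬ P.1 ≤ L.1) :
    ∃ p, aline b p = L := by
  apply exists_aline
  rwa [c.hP, Submodule.span_singleton_le_iff_mem] at h

lemma P_ne_M (c : Coords Ω P M b f) : P ≠ M := by
  intro h
  have h1 := c.P_not_le (0, 0)
  rw [h, c.M_le] at h1
  exact h1 rfl

lemma appt_ne_P (c : Coords Ω P M b f) (x y : F) : appt b x y ≠ P := by
  intro h
  have h1 := c.P_not_le (0, y)
  rw [← h, appt_le_aline] at h1
  simp at h1

lemma appt_ne_M (c : Coords Ω P M b f) (x y : F) : appt b x y ≠ M := by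
  intro h
  have h1 : M.1 ≤ (aline b (0, y)).1 := (c.M_le _).2 rfl
  have h2 : ¬ M.1 ≤ (aline b (1, y - x)).1 := by rw [c.M_le]; simp
  rw [← h, appt_le_aline] at h2
  simp at h2

lemma appt_mem (c : Coords Ω P M b f) (x : F) : appt b x (f x) ∈ Ω :=
  (c.mem' _).2 (Or.inr (Or.inr ⟨x, rfl⟩))

lemma M_mem (c : Coords Ω P M b f) : M ∈ Ω := (c.mem' _).2 (Or.inr (Or.inl rfl))

lemma P_mem (c : Coords Ω P M b f) : P ∈ Ω := (c.mem' _).2 (Or.inl rfl)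

variable [Fintype F] [DecidableEq F]

lemma meets_iff (c : Coords Ω P M b f) (p : F × F) :
    (∃ Q ∈ Ω, Q.1 ≤ (aline b p).1) ↔ ixN f p.1 p.2 ≠ 0 := by
  constructor
  · rintro ⟨Q, hQ, hL⟩ h0
    rcases (c.mem' Q).1 hQ with rfl | rfl | ⟨x, rfl⟩
    · exact c.P_not_le p hL
    · rw [c.M_le] at hL
      simp [ixN, hL] at h0
    · rw [appt_le_aline] at hL
      simp only [ixN, Nat.add_eq_zero_iff, Finset.card_eq_zero, Finset.filter_eq_empty_iff] at h0
      exact h0.1 (Finset.mem_univ x) hL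
  · intro h
    by_cases h0 : p.1 = 0
    · exact ⟨M, c.M_mem, (c.M_le p).2 h0⟩
    · simp only [ixN, h0, if_false, add_zero] at h
      obtain ⟨x, hx⟩ := Finset.card_ne_zero.1 h
      exact ⟨_, c.appt_mem x, (appt_le_aline _ _ _ _).2 (Finset.mem_filter.1 hx).2⟩

lemma eqHyp (c : Coords Ω P M b f) (hn : IsInternalNucleus Ω P)
    (hΩ : Ω.ncard = Fintype.card F + 2)
    (heq : 2 * {L : ProjLine F | ∃ P ∈ Ω, P.1 ≤ L.1}.ncard
      = (Fintype.card F + 1) * (Fintype.card F + 2) + (Fintype.card F - 1)) : EqHyp f := by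
  have hfin : Finite (ProjLine F) := inferInstance
  have hfinP : Finite (ProjPoint F) := inferInstance
  have hA : {L : ProjLine F | P.1 ≤ L.1}.ncard = Fintype.card F + 1 := by
    have h1 : (Ω \ {P}).ncard = Fintype.card F + 1 := by
      rw [Set.ncard_sdiff_singleton_of_mem c.P_mem, hΩ]; rfl
    rw [← h1]
    symm
    apply Set.ncard_congr (fun Q (hQ : Q ∈ Ω \ {P}) => joinL (P := P) (Q := Q) (fun h => hQ.2 h.symm))
    · intro Q hQ
      exact (le_sup_left : P.1 ≤ P.1 ⊔ Q.1)
    · intro Q R hQ hR h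
      have hQ1 : Q.1 ≤ (joinL (P := P) (Q := Q) (fun h => hQ.2 h.symm)).1 :=
        (le_sup_right : Q.1 ≤ P.1 ⊔ Q.1)
      have hP1 : P.1 ≤ (joinL (P := P) (Q := Q) (fun h => hQ.2 h.symm)).1 :=
        (le_sup_left : P.1 ≤ P.1 ⊔ Q.1)
      have hR1 : R.1 ≤ (joinL (P := P) (Q := R) (fun h => hR.2 h.symm)).1 :=
        (le_sup_right : R.1 ≤ P.1 ⊔ R.1)
      rw [← h] at hR1
      exact nuc_unique hn _ hP1 hQ.1 hQ.2 hQ1 hR.1 hR.2 hR1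
    · intro L hL
      obtain ⟨Q, ⟨hQ, hQP, hQL⟩, -⟩ := hn.2 L hL
      exact ⟨Q, ⟨hQ, hQP⟩, eq_join _ L hL hQL⟩
  have hB : {L : ProjLine F | ¬ P.1 ≤ L.1 ∧ ∃ Q ∈ Ω, Q.1 ≤ L.1}.ncard =
      (Finset.univ.filter (fun p : F × F => ixN f p.1 p.2 ≠ 0)).card := by
    have : {L : ProjLine F | ¬ P.1 ≤ L.1 ∧ ∃ Q ∈ Ω, Q.1 ≤ L.1} =
        aline b '' ((Finset.univ.filter (fun p : F × F => ixN f p.1 p.2 ≠ 0) : Finset (F × F)) : Set (F × F)) := by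
      ext L
      constructor
      · rintro ⟨h1, h2⟩
        obtain ⟨p, rfl⟩ := c.exists_line L h1
        refine ⟨p, ?_, rfl⟩
        simpa using (c.meets_iff p).1 h2
      · rintro ⟨p, hp, rfl⟩
        refine ⟨c.P_not_le p, (c.meets_iff p).2 ?_⟩
        simpa using hp
    rw [this, Set.ncard_image_of_injective _ (aline_inj b), Set.ncard_coe_finset]
  have hU : {L : ProjLine F | ∃ P ∈ Ω, P.1 ≤ L.1} = {L : ProjLine F | P.1 ≤ L.1} ∪
      {L : ProjLine F | ¬ P.1 ≤ L.1 ∧ ∃ Q ∈ Ω, Q.1 ≤ L.1} := by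
    ext L
    simp only [Set.mem_ofPred_eq, Set.mem_union]
    constructor
    · intro h
      by_cases hP : P.1 ≤ L.1
      · exact Or.inl hP
      · exact Or.inr ⟨hP, h⟩
    · rintro (h | h)
      · exact ⟨P, c.P_mem, h⟩
      · exact h.2
  have hdis : Disjoint {L : ProjLine F | P.1 ≤ L.1}
      {L : ProjLine F | ¬ P.1 ≤ L.1 ∧ ∃ Q ∈ Ω, Q.1 ≤ L.1} := by
    rw [Set.disjoint_left]
    intro L h1 h2
    exact h2.1 h1
  rw [hU, Set.ncard_union_eq hdis (Set.toFinite _) (Set.toFinite _), hA, hB] at heq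
  have hs : (∑ μ, ∑ c, if ixN f μ c ≠ 0 then (1:ℤ) else 0) =
      ((Finset.univ.filter (fun p : F × F => ixN f p.1 p.2 ≠ 0)).card : ℤ) := by
    rw [← Fintype.sum_prod_type' (f := fun μ c => if ixN f μ c ≠ 0 then (1:ℤ) else 0)]
    rw [Finset.card_filter]
    push_cast
    rfl
  unfold EqHyp
  rw [hs]
  have hpos : 1 ≤ Fintype.card F := Fintype.card_pos
  generalize (Finset.univ.filter (fun p : F × F => ixN f p.1 p.2 ≠ 0)).card = T at heq ⊢
  zify [hpos] at heq
  linarith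

end Coords
end geom2
section fin
variable {F : Type*} [Field F]

lemma inj_of_NT {Ω : Set (ProjPoint F)} {P M : ProjPoint F} {b : Bas F} {f : F → F}
    (c : Coords Ω P M b f)
    (h : ∀ L : ProjLine F, M.1 ≤ L.1 → ∀ Q ∈ Ω, ∀ R ∈ Ω, Q ≠ M → R ≠ M → Q.1 ≤ L.1 → R.1 ≤ L.1 → Q = R) :
    Function.Injective f := by
  intro x x' hx
  have := h (aline b (0, f x)) ((c.M_le _).2 rfl) _ (c.appt_mem x) _ (c.appt_mem x')
    (c.appt_ne_M _ _) (c.appt_ne_M _ _) ((appt_le_aline _ _ _ _).2 (by simp))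
    ((appt_le_aline _ _ _ _).2 (by simp [hx]))
  exact (appt_inj b this).1

lemma exists_inj [Fintype F] [DecidableEq F] (hodd : Odd (Fintype.card F))
    (Ω : Set (ProjPoint F)) (P : ProjPoint F) (hn : IsInternalNucleus Ω P)
    (hΩ : Ω.ncard = Fintype.card F + 2)
    (heq : 2 * {L : ProjLine F | ∃ P ∈ Ω, P.1 ≤ L.1}.ncard
      = (Fintype.card F + 1) * (Fintype.card F + 2) + (Fintype.card F - 1)) :
    ∃ M b f, Coords Ω P M b f ∧ Function.Injective f ∧ EqHyp f := by
  obtain ⟨M, hM, hMP⟩ := Set.exists_ne_of_one_lt_ncard (s := Ω) (by omega) P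
  obtain ⟨b, f, c⟩ := exists_coords Ω P M hn hM hMP
  have hf := c.eqHyp hn hΩ heq
  rcases second_nucleus f hodd hf with h | ⟨a, ha⟩
  · refine ⟨M, b, f, c, ?_, hf⟩
    intro x x' hx
    have := h (f x)
    simp only [ixN, if_true, zero_mul, zero_add] at this
    have h1 : (Finset.univ.filter fun y => f y = f x).card ≤ 1 := by omega
    rw [Finset.card_le_one] at h1
    exact h1 x (by simp) x' (by simp [hx])
  · have hN := c.appt_mem a
    obtain ⟨b', f', c'⟩ := exists_coords Ω P (appt b a (f a)) hn hN (c.appt_ne_P _ _)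
    refine ⟨_, b', f', c', inj_of_NT c' ?_, c'.eqHyp hn hΩ heq⟩
    intro L hL Q hQ R hR hQN hRN hQL hRL
    by_cases hPL : P.1 ≤ L.1
    · have key : ∀ S ∈ Ω, S ≠ appt b a (f a) → S.1 ≤ L.1 → S = P := by
        intro S hS hSN hSL
        by_contra hSP
        exact hSN (nuc_unique hn L hPL hS hSP hSL hN (c.appt_ne_P _ _) hL)
      rw [key Q hQ hQN hQL, key R hR hRN hRL]
    · obtain ⟨⟨μ, d⟩, rfl⟩ := c.exists_line L hPL
      rw [appt_le_aline] at hL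
      simp only at hL
      have hd : d = f a - μ * a := by linear_combination -hL
      have h2 := ha μ
      rw [← hd] at h2
      have haS : a ∈ Finset.univ.filter fun x => f x = μ * x + d := by simpa using hL
      rcases (c.mem' Q).1 hQ with rfl | rfl | ⟨x, rfl⟩
      · exact absurd hQL hPL
      · rw [c.M_le] at hQL
        simp only at hQL
        rcases (c.mem' R).1 hR with rfl | rfl | ⟨y, rfl⟩
        · exact absurd hRL hPL
        · rfl
        · exfalso
          rw [appt_le_aline] at hRL
          simp only [ixN, hQL, if_true] at h2
          have h1 : (Finset.univ.filter fun y => f y = 0 * y + d).card ≤ 1 := by omega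
          rw [Finset.card_le_one] at h1
          rw [hQL] at haS
          have := h1 a haS y (by simpa [hQL] using hRL)
          subst this
          exact hRN rfl
      · rw [appt_le_aline] at hQL
        simp only at hQL
        have hxa : x ≠ a := by rintro rfl; exact hQN rfl
        rcases (c.mem' R).1 hR with rfl | rfl | ⟨y, rfl⟩
        · exact absurd hRL hPL
        · exfalso
          rw [c.M_le] at hRL
          simp only at hRL
          simp only [ixN, hRL, if_true] at h2
          have h1 : (Finset.univ.filter fun y => f y = 0 * y + d).card ≤ 1 := by omega
          rw [Finset.card_le_one] at h1
          rw [hRL] at haS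
          exact hxa (h1 a haS x (by simpa [hRL] using hQL)).symm
        · rw [appt_le_aline] at hRL
          simp only at hRL
          have hya : y ≠ a := by rintro rfl; exact hRN rfl
          by_contra hne
          have hxy : x ≠ y := by rintro rfl; exact hne rfl
          have h3 : ({a, x, y} : Finset F).card = 3 := by
            rw [Finset.card_eq_three]
            exact ⟨a, x, y, hxa.symm, hya.symm, hxy, rfl⟩
          have h4 : ({a, x, y} : Finset F) ⊆ Finset.univ.filter fun x => f x = μ * x + d := by
            intro z hz
            simp only [Finset.mem_insert, Finset.mem_singleton] at hz
            rcases hz with rfl | rfl | rfl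
            · exact haS
            · simpa using hQL
            · simpa using hRL
          have h5 := Finset.card_le_card h4
          unfold ixN at h2
          omega

/-- the quadratic form `(X - n Z) (Y - m Z) - K Z ^ 2` -/
noncomputable def qform (b : Bas F) (n m K : F) : QuadraticForm F (Fin 3 → F) :=
  QuadraticMap.linMulLin (b.coord 2 - n • b.coord 0) (b.coord 1 - m • b.coord 0)
    - K • QuadraticMap.linMulLin (b.coord 0) (b.coord 0)

lemma qform_apply (b : Bas F) (n m K : F) (v : Fin 3 → F) :
    qform b n m K v = (b.coord 2 v - n * b.coord 0 v) * (b.coord 1 v - m * b.coord 0 v)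
      - K * (b.coord 0 v * b.coord 0 v) := by
  simp only [qform, QuadraticMap.sub_apply, QuadraticMap.smul_apply, QuadraticMap.linMulLin_apply,
    LinearMap.sub_apply, LinearMap.smul_apply, smul_eq_mul]

lemma qform_apt (b : Bas F) (n m K x y : F) :
    qform b n m K (apt b x y) = (x - n) * (y - m) - K := by
  obtain ⟨h0, h1, h2⟩ := coord_apt b x y
  rw [qform_apply, h0, h1, h2]; ring

lemma qform_nondeg (b : Bas F) (n m K : F) (h2 : (2 : F) ≠ 0) (hK : K ≠ 0) :
    (QuadraticMap.polarBilin (qform b n m K)).Nondegenerate := by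
  have key : ∀ v, (∀ w, QuadraticMap.polar (qform b n m K) v w = 0) → v = 0 := by
    intro v hv
    have e1 := hv (b 1)
    have e2 := hv (b 2)
    have e0 := hv (b 0)
    simp only [QuadraticMap.polar, qform_apply, map_add] at e0 e1 e2
    simp at e0 e1 e2
    have hz : b.repr v 0 = 0 := by
      have : (2 * K) * b.repr v 0 = 0 := by
        linear_combination -e0 - n * e2 - m * e1
      rcases mul_eq_zero.1 this with h | h
      · exact absurd h (mul_ne_zero h2 hK)
      · exact h
    have hx : b.repr v 2 = 0 := by rw [hz] at e1; linear_combination e1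
    have hy : b.repr v 1 = 0 := by rw [hz] at e2; linear_combination e2
    rw [expand b v]
    simp [hx, hy, hz]
  constructor
  · intro v hv
    exact key v (fun w => by simpa using hv w)
  · intro v hv
    exact key v (fun w => by rw [QuadraticMap.polar_comm]; simpa using hv w)

lemma mem_zeros_iff (Q : QuadraticForm F (Fin 3 → F)) (P : ProjPoint F) (v : Fin 3 → F)
    (h : P.1 = Submodule.span F {v}) : P ∈ ProjZeros Q ↔ Q v = 0 := by
  constructor
  · intro hP
    apply hP
    rw [h]; exact Submodule.mem_span_singleton_self _
  · intro hv w hw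
    rw [h] at hw
    obtain ⟨a, rfl⟩ := Submodule.mem_span_singleton.1 hw
    rw [QuadraticMap.map_smul, hv, smul_zero]

lemma conic_zeros {Ω : Set (ProjPoint F)} {P M : ProjPoint F} {b : Bas F} {f : F → F}
    (c : Coords Ω P M b f) (n K : F) (hK : K ≠ 0)
    (h : ∀ x, x ≠ n → (x - n) * (f x - f n) = K) :
    Ω \ {appt b n (f n)} = ProjZeros (qform b n (f n) K) := by
  have zP : P ∈ ProjZeros (qform b n (f n) K) := by
    rw [mem_zeros_iff _ _ _ c.hP, qform_apply]; simp
  have zM : M ∈ ProjZeros (qform b n (f n) K) := by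
    rw [mem_zeros_iff _ _ _ c.hM, qform_apply]; simp
  have zA : ∀ x y, appt b x y ∈ ProjZeros (qform b n (f n) K) ↔ (x - n) * (y - f n) = K := by
    intro x y
    rw [mem_zeros_iff _ (appt b x y) (apt b x y) rfl, qform_apt, sub_eq_zero]
  ext Q
  constructor
  · rintro ⟨hQ, hQN⟩
    rcases (c.mem' Q).1 hQ with rfl | rfl | ⟨x, rfl⟩
    · exact zP
    · exact zM
    · rw [zA]
      apply h
      rintro rfl
      exact hQN rfl
  · intro hQ
    obtain ⟨v, hv0, hv⟩ := exists_gen Q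
    by_cases hz : b.coord 0 v = 0
    · rw [mem_zeros_iff _ _ _ hv, qform_apply, hz] at hQ
      simp only [mul_zero, sub_zero, mul_eq_zero] at hQ
      have he := expand b v
      rw [hz] at he
      rcases hQ with h' | h'
      · have : Q = P := by
          apply Subtype.ext
          rw [hv]; symm
          apply gen_of_mem P _ hv0
          rw [c.hP, he, h']
          simp only [zero_smul, zero_add, add_zero]
          exact Submodule.smul_mem _ _ (Submodule.mem_span_singleton_self _)
        rw [this]
        exact ⟨c.P_mem, fun h => c.appt_ne_P _ _ h.symm⟩
      · have : Q = M := by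
          apply Subtype.ext
          rw [hv]; symm
          apply gen_of_mem M _ hv0
          rw [c.hM, he, h']
          simp only [zero_smul, add_zero]
          exact Submodule.smul_mem _ _ (Submodule.mem_span_singleton_self _)
        rw [this]
        exact ⟨c.M_mem, fun h => c.appt_ne_M _ _ h.symm⟩
    · have hQe : Q = appt b (b.coord 2 v / b.coord 0 v) (b.coord 1 v / b.coord 0 v) := by
        apply Subtype.ext
        rw [hv, normalize_pt b v hz]; rfl
      generalize b.coord 2 v / b.coord 0 v = x at hQe
      generalize b.coord 1 v / b.coord 0 v = y at hQe
      subst hQe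
      rw [zA] at hQ
      have hxn : x ≠ n := by
        rintro rfl
        rw [sub_self, zero_mul] at hQ
        exact hK hQ.symm
      have hy : y = f x := by
        have := h x hxn
        rw [← hQ] at this
        have := mul_left_cancel₀ (sub_ne_zero.2 hxn) this
        linear_combination -this
      subst hy
      exact ⟨c.appt_mem x, fun h' => hxn (appt_inj b h').1⟩

end fin

/-- **Equality case.** For `q` an odd prime power and `Ω` a set of `q+2` points
of `PG(2,q)` with an internal nucleus: if the number of lines meeting `Ω`
equals `(q+1)(q+2)/2 + (q-1)/2`, then `Ω` consists of the points of an
irreducible conic (the projective zeros of a nondegenerate quadratic form)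
together with an external point `N` (a point off the conic lying on two
tangent lines). -/
theorem intersecting_lines_equality_case {F : Type*} [Field F] [Fintype F] (q : ℕ)
    (hq : Fintype.card F = q) (hodd : Odd q)
    (Ω : Set (ProjPoint F)) (hΩ : Ω.ncard = q + 2)
    (hnuc : ∃ P : ProjPoint F, IsInternalNucleus Ω P)
    (heq : 2 * {L : ProjLine F | ∃ P ∈ Ω, P.1 ≤ L.1}.ncard
      = (q + 1) * (q + 2) + (q - 1)) :
    ∃ N ∈ Ω, ∃ Q : QuadraticForm F (Fin 3 → F),
      (QuadraticMap.polarBilin Q).Nondegenerate ∧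
      Ω \ {N} = ProjZeros Q ∧
      N ∉ ProjZeros Q ∧
      ∃ L₁ L₂ : ProjLine F, L₁ ≠ L₂ ∧ N.1 ≤ L₁.1 ∧ N.1 ≤ L₂.1 ∧
        IsTangentLine (ProjZeros Q) L₁ ∧ IsTangentLine (ProjZeros Q) L₂ := by
  classical
  subst hq
  obtain ⟨P, hn⟩ := hnuc
  obtain ⟨M, b, f, c, hinj, hf⟩ := exists_inj hodd Ω P hn hΩ heq
  have h2 : (2 : F) ≠ 0 := by
    apply Ring.two_ne_zero
    intro hc
    have := FiniteField.even_card_iff_char_two.1 hc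
    have := Nat.odd_iff.1 hodd
    omega
  obtain ⟨n, K, hK, hc⟩ := conic_of_eq f hinj h2 hf
  have hz := conic_zeros c n K hK hc
  refine ⟨appt b n (f n), c.appt_mem n, qform b n (f n) K, qform_nondeg b _ _ _ h2 hK, hz, ?_,
    joinL (c.appt_ne_P n (f n)), aline b (0, f n), ?_, ?_, ?_, ?_, ?_⟩
  · rw [← hz]; exact fun h => h.2 rfl
  · intro h
    apply c.P_not_le (0, f n)
    rw [← h]
    exact (le_sup_right : P.1 ≤ (appt b n (f n)).1 ⊔ P.1)
  · exact (le_sup_left : (appt b n (f n)).1 ≤ (appt b n (f n)).1 ⊔ P.1)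
  · rw [appt_le_aline]; simp
  · rw [← hz]
    refine ⟨P, ⟨⟨c.P_mem, fun h => c.appt_ne_P _ _ h.symm⟩,
      (le_sup_right : P.1 ≤ (appt b n (f n)).1 ⊔ P.1)⟩, ?_⟩
    rintro Q ⟨⟨hQ, hQN⟩, hQL⟩
    by_contra hQP
    exact hQN (nuc_unique hn _ (le_sup_right : P.1 ≤ (appt b n (f n)).1 ⊔ P.1) hQ hQP hQL
      (c.appt_mem n) (c.appt_ne_P _ _)
      (le_sup_left : (appt b n (f n)).1 ≤ (appt b n (f n)).1 ⊔ P.1))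
  · rw [← hz]
    refine ⟨M, ⟨⟨c.M_mem, fun h => c.appt_ne_M _ _ h.symm⟩, (c.M_le _).2 rfl⟩, ?_⟩
    rintro Q ⟨⟨hQ, hQN⟩, hQL⟩
    rcases (c.mem' Q).1 hQ with rfl | rfl | ⟨x, rfl⟩
    · exact absurd hQL (c.P_not_le _)
    · rfl
    · rw [appt_le_aline] at hQL
      simp only [zero_mul, zero_add] at hQL
      have := hinj hQL
      subst this
      exact absurd rfl hQN
end

section
/- Let ℓ be a line of PG(2,q) and, for each point P ∈ ℓ, let ℓ_P be a line through P with ℓ_P ≠ ℓ. Then the set K = (⋃_{P∈ℓ} ℓ_P) \ ℓ is a dual blocking set in PG(2,q): it contains no line and meets every blocking set. -/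
/-- The set of points of `PG(2,q)` lying on a line `L`. -/
def linePoints {F : Type*} [Field F] (L : ProjLine F) : Set (ProjPoint F) :=
  {P : ProjPoint F | P.1 ≤ L.1}

/-- A blocking set in `PG(2,q)`: a set of points meeting every line and
containing no line. -/
def IsBlockingSet {F : Type*} [Field F] (B : Set (ProjPoint F)) : Prop :=
  (∀ L : ProjLine F, ∃ P ∈ B, P.1 ≤ L.1) ∧ ∀ L : ProjLine F, ¬ linePoints L ⊆ B

/-- A dual blocking set in `PG(2,q)`: a set of points meeting every blocking
set and containing no line. -/
def IsDualBlockingSet {F : Type*} [Field F] (S : Set (ProjPoint F)) : Prop :=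
  (∀ B : Set (ProjPoint F), IsBlockingSet B → (S ∩ B).Nonempty) ∧
    ∀ L : ProjLine F, ¬ linePoints L ⊆ S

/-- Every Kakeya set `K = (⋃_{P ∈ ℓ} ℓ_P) \ ℓ` in `PG(2,q)` — where for each
point `P` of the line `ℓ`, `ℓ_P ≠ ℓ` is a line through `P` — is a dual
blocking set. -/
theorem kakeya_is_dual_blocking {F : Type*} [Field F] [Fintype F]
    (hq : 2 < Fintype.card F)
    (ℓ : ProjLine F) (f : ∀ P : ProjPoint F, P.1 ≤ ℓ.1 → ProjLine F)
    (hf : ∀ (P : ProjPoint F) (h : P.1 ≤ ℓ.1), P.1 ≤ (f P h).1 ∧ f P h ≠ ℓ) :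
    IsDualBlockingSet
      {Q : ProjPoint F | (∃ (P : ProjPoint F) (h : P.1 ≤ ℓ.1), Q.1 ≤ (f P h).1)
        ∧ ¬ Q.1 ≤ ℓ.1} := by
  have hd : Module.finrank F (Fin 3 → F) = 3 := by simp
  refine ⟨?_, ?_⟩
  · rintro B ⟨hB1, hB2⟩
    obtain ⟨P, hPl, hPB⟩ := Set.not_subset.mp (hB2 ℓ)
    have hPl' : P.1 ≤ ℓ.1 := hPl
    obtain ⟨hP1, hP2⟩ := hf P hPl'
    obtain ⟨Q, hQB, hQ⟩ := hB1 (f P hPl')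
    refine ⟨Q, ⟨⟨P, hPl', hQ⟩, fun hQl => ?_⟩, hQB⟩
    have hne : P.1 ≠ Q.1 := fun h => hPB (Subtype.ext h ▸ hQB)
    have hsup : 2 ≤ Module.finrank F (P.1 ⊔ Q.1 : Submodule F (Fin 3 → F)) := by
      by_contra hlt
      have e1 : P.1 = P.1 ⊔ Q.1 :=
        Submodule.eq_of_le_of_finrank_le le_sup_left (by rw [P.2]; omega)
      have e2 : Q.1 = P.1 ⊔ Q.1 :=
        Submodule.eq_of_le_of_finrank_le le_sup_right (by rw [Q.2]; omega)
      exact hne (e1.trans e2.symm)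
    have e1 : P.1 ⊔ Q.1 = ℓ.1 :=
      Submodule.eq_of_le_of_finrank_le (sup_le hPl' hQl) (by rw [ℓ.2]; exact hsup)
    have e2 : P.1 ⊔ Q.1 = (f P hPl').1 :=
      Submodule.eq_of_le_of_finrank_le (sup_le hP1 hQ) (by rw [(f P hPl').2]; exact hsup)
    exact hP2 (Subtype.ext (e2.symm.trans e1))
  · intro L hL
    have h1 := Submodule.finrank_sup_add_finrank_inf_eq L.1 ℓ.1
    have h2 := Submodule.finrank_le (L.1 ⊔ ℓ.1)
    rw [L.2, ℓ.2] at h1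
    rw [hd] at h2
    have hne : L.1 ⊓ ℓ.1 ≠ ⊥ := by
      intro h
      rw [h, finrank_bot] at h1
      omega
    obtain ⟨v, hv, hv0⟩ := Submodule.exists_mem_ne_zero_of_ne_bot hne
    have hle : Submodule.span F {v} ≤ L.1 ⊓ ℓ.1 := by
      rw [Submodule.span_singleton_le_iff_mem]; exact hv
    have := hL (show (⟨Submodule.span F {v}, finrank_span_singleton hv0⟩ : ProjPoint F)
      ∈ linePoints L from hle.trans inf_le_left)
    exact this.2 (hle.trans inf_le_right)
end

section
/- Let ℓ and m be two distinct lines of PG(2,q), q > 2. Then the complement S = PG(2,q) \ (ℓ ∪ m) of their union is a dual blocking set: it contains no line and meets every blocking set. -/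
lemma sup_finrank_two {F : Type*} [Field F] (X Y : ProjPoint F) (h : X ≠ Y) :
    Module.finrank F (X.1 ⊔ Y.1 : Submodule F (Fin 3 → F)) = 2 := by
  have h1 := Submodule.finrank_sup_add_finrank_inf_eq X.1 Y.1
  rw [X.2, Y.2] at h1
  have h2 : Module.finrank F (X.1 ⊓ Y.1 : Submodule F (Fin 3 → F)) ≠ 1 := by
    intro h3
    apply h
    apply Subtype.ext
    have a := Submodule.eq_of_le_of_finrank_eq (inf_le_left : X.1 ⊓ Y.1 ≤ X.1) (by rw [h3, X.2])
    have b := Submodule.eq_of_le_of_finrank_eq (inf_le_right : X.1 ⊓ Y.1 ≤ Y.1) (by rw [h3, Y.2])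
    exact a.symm.trans b
  have h4 := Submodule.finrank_mono (inf_le_left : X.1 ⊓ Y.1 ≤ X.1)
  rw [X.2] at h4
  omega

lemma line_unique {F : Type*} [Field F] {X Y : ProjPoint F} {L M : ProjLine F} (hLM : L ≠ M)
    (h1 : X.1 ≤ L.1) (h2 : Y.1 ≤ L.1) (h3 : X.1 ≤ M.1) (h4 : Y.1 ≤ M.1) : X = Y := by
  by_contra h
  have hs := sup_finrank_two X Y h
  apply hLM
  apply Subtype.ext
  rw [← Submodule.eq_of_le_of_finrank_eq (sup_le h1 h2) (by rw [hs, L.2]),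
    ← Submodule.eq_of_le_of_finrank_eq (sup_le h3 h4) (by rw [hs, M.2])]

lemma exists_meet {F : Type*} [Field F] (L M : ProjLine F) :
    ∃ X : ProjPoint F, X.1 ≤ L.1 ∧ X.1 ≤ M.1 := by
  have h1 := Submodule.finrank_sup_add_finrank_inf_eq L.1 M.1
  have h2 := Submodule.finrank_le (L.1 ⊔ M.1)
  rw [L.2, M.2] at h1
  rw [Module.finrank_fin_fun] at h2
  have h3 : L.1 ⊓ M.1 ≠ ⊥ := by
    intro h
    rw [h, finrank_bot] at h1
    omega
  obtain ⟨v, hv, hv0⟩ := Submodule.exists_mem_ne_zero_of_ne_bot h3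
  refine ⟨⟨F ∙ v, finrank_span_singleton hv0⟩, ?_, ?_⟩
  · exact (Submodule.span_singleton_le_iff_mem _ _).2 hv.1
  · exact (Submodule.span_singleton_le_iff_mem _ _).2 hv.2

lemma exists_vec {F : Type*} [Field F] {L M : ProjLine F} (h : L ≠ M) :
    ∃ v ∈ L.1, v ∉ M.1 := by
  by_contra! hc
  exact h (Subtype.ext (Submodule.eq_of_le_of_finrank_eq hc (by rw [L.2, M.2])))

/-- The complement of the union of two distinct lines of `PG(2,q)`, `q > 2`,
is a dual blocking set. -/
theorem complement_two_lines_is_dual_blocking {F : Type*} [Field F] [Fintype F]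
    (hq : 2 < Fintype.card F)
    (ℓ m : ProjLine F) (hlm : ℓ ≠ m) :
    IsDualBlockingSet {P : ProjPoint F | ¬ P.1 ≤ ℓ.1 ∧ ¬ P.1 ≤ m.1} := by
  refine ⟨?_, ?_⟩
  · rintro B ⟨hB, hB'⟩
    by_contra hne
    have hsub : ∀ X ∈ B, X.1 ≤ ℓ.1 ∨ X.1 ≤ m.1 := by
      intro X hX
      by_contra hc
      rw [not_or] at hc
      exact hne ⟨X, hc, hX⟩
    -- the common point lies in `B`
    have hR : ∀ R : ProjPoint F, R.1 ≤ ℓ.1 → R.1 ≤ m.1 → R ∈ B := by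
      intro R hRl hRm
      obtain ⟨a, hal, ham⟩ := exists_vec hlm
      obtain ⟨b, hbm, hbl⟩ := exists_vec hlm.symm
      have hl : a + b ∉ ℓ.1 := fun h => hbl ((Submodule.add_mem_iff_right _ hal).1 h)
      have hm : a + b ∉ m.1 := fun h => ham ((Submodule.add_mem_iff_left _ hbm).1 h)
      have h0 : a + b ≠ 0 := fun h => hl (h ▸ ℓ.1.zero_mem)
      let C : ProjPoint F := ⟨F ∙ (a + b), finrank_span_singleton h0⟩
      have hC : a + b ∈ C.1 := Submodule.mem_span_singleton_self _
      have hRC : R ≠ C := fun h => hl (hRl (h ▸ hC))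
      let L : ProjLine F := ⟨R.1 ⊔ C.1, sup_finrank_two R C hRC⟩
      have hRL : R.1 ≤ L.1 := le_sup_left
      have hCL : C.1 ≤ L.1 := le_sup_right
      have hLl : L ≠ ℓ := fun h => hl (h ▸ hCL hC)
      have hLm : L ≠ m := fun h => hm (h ▸ hCL hC)
      obtain ⟨X, hXB, hXL⟩ := hB L
      rcases hsub X hXB with h | h
      · exact line_unique hLl hXL hRL h hRl ▸ hXB
      · exact line_unique hLm hXL hRL h hRm ▸ hXB
    obtain ⟨P, hPl, hPB⟩ := Set.not_subset.1 (hB' ℓ)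
    obtain ⟨Q, hQm, hQB⟩ := Set.not_subset.1 (hB' m)
    change P.1 ≤ ℓ.1 at hPl
    change Q.1 ≤ m.1 at hQm
    have hPm : ¬ P.1 ≤ m.1 := fun h => hPB (hR P hPl h)
    have hQl : ¬ Q.1 ≤ ℓ.1 := fun h => hQB (hR Q h hQm)
    have hPQ : P ≠ Q := fun h => hPm (h ▸ hQm)
    let L : ProjLine F := ⟨P.1 ⊔ Q.1, sup_finrank_two P Q hPQ⟩
    have hPL : P.1 ≤ L.1 := le_sup_left
    have hQL : Q.1 ≤ L.1 := le_sup_right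
    have hLl : L ≠ ℓ := fun h => hQl (h ▸ hQL)
    have hLm : L ≠ m := fun h => hPm (h ▸ hPL)
    obtain ⟨X, hXB, hXL⟩ := hB L
    rcases hsub X hXB with h | h
    · exact hPB (line_unique hLl hXL hPL h hPl ▸ hXB)
    · exact hQB (line_unique hLm hXL hQL h hQm ▸ hXB)
  · intro L hL
    obtain ⟨X, h1, h2⟩ := exists_meet L ℓ
    exact (hL h1).1 h2
end

section
/- Every dual blocking set S in PG(2,q), q > 2, satisfies |S| ≥ q(q+1)/2. Equality holds if and only if either (i) q is even and S = (⋃_{P∈ℓ} ℓ_P) \ ℓ where {ℓ} ∪ {ℓ_P : P ∈ ℓ} is a dual hyperoval (a set of q+2 lines no three of which are concurrent) with ℓ one of its lines and ℓ_P the second line of the hyperoval through P, or (ii) q = 3 and S is the complement of the union of two distinct lines. -/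
/-- Incidence axioms of a finite projective plane of order `q` (as needed below). -/
structure PlaneAx {P L : Type*} [Fintype P] (I : P → L → Prop) (q : ℕ) : Prop where
  pt : ∀ l m : L, l ≠ m → ∃ p, I p l ∧ I p m
  ln : ∀ p r : P, p ≠ r → ∃ l, I p l ∧ I r l
  uniq : ∀ (p r : P) (l m : L), p ≠ r → I p l → I r l → I p m → I r m → l = m
  cardL : ∀ l : L, Nat.card {p // I p l} = q + 1
  cardP : Fintype.card P = q ^ 2 + q + 1

namespace PlaneAx
open Classical Finset

variable {P L : Type*} [Fintype P] {I : P → L → Prop} {q : ℕ}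

theorem line_card (h : PlaneAx I q) (l : L) : #{p | I p l} = q + 1 := by
  rw [← h.cardL l, Nat.card_eq_fintype_card, Fintype.card_subtype]

theorem inter_card (h : PlaneAx I q) {l m : L} (hne : l ≠ m) : #{p | I p l ∧ I p m} = 1 := by
  obtain ⟨p, hp⟩ := h.pt l m hne
  rw [Finset.card_eq_one]
  refine ⟨p, ?_⟩
  ext r
  simp only [mem_filter, mem_univ, true_and, mem_singleton]
  constructor
  · intro hr
    by_contra hc
    exact hne (h.uniq r p l m hc hr.1 hp.1 hr.2 hp.2)
  · rintro rfl; exact hp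

theorem affine_card (h : PlaneAx I q) {l m : L} (hne : l ≠ m) :
    #{p | ¬ I p m ∧ I p l} = q := by
  have h1 := h.line_card l
  have h2 := h.inter_card hne
  have h3 := card_filter_add_card_filter_not (s := univ.filter (fun p => I p l)) (fun p => I p m)
  rw [filter_filter, filter_filter, h1, h2] at h3
  have : #{p | ¬ I p m ∧ I p l} = #{p | I p l ∧ ¬ I p m} := by
    congr 1; ext; simp [and_comm]
  omega

/-- Complement of two lines. -/
theorem compl_card (h : PlaneAx I q) {l m : L} (hne : l ≠ m) :
    #{p | ¬ I p l ∧ ¬ I p m} + q = q ^ 2 := by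
  have h1 := h.line_card l
  have h2 := h.affine_card hne.symm
  have h3 := card_filter_add_card_filter_not (s := (univ : Finset P)) (fun p => I p l)
  have h4 := card_filter_add_card_filter_not (s := univ.filter (fun p => ¬ I p l))
    (fun p => I p m)
  rw [filter_filter, filter_filter] at h4
  have := h.cardP
  rw [← card_univ] at this
  omega

/-- number of lines `f X` through `Q`. -/
noncomputable def r (l : L) (f : {X // I X l} → L) (Q : P) : ℕ := #{X | I Q (f X)}

section count
variable {l : L} {f : {X // I X l} → L}

theorem meet_affine (h : PlaneAx I q) (hf : ∀ X, I X.1 (f X) ∧ f X ≠ l) {m : L} {X : P}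
    (hX : I X l) (hXm : I X m) (hm : m ≠ l) (Y : {X // I X l}) (hY : Y.1 ≠ X) :
    #{Q | (¬ I Q l ∧ I Q m) ∧ I Q (f Y)} = 1 := by
  have hne : m ≠ f Y := by
    intro e
    exact hm (h.uniq Y.1 X m l hY (e ▸ (hf Y).1) hXm Y.2 hX)
  rw [← h.inter_card hne]
  congr 1
  ext Q
  simp only [mem_filter, mem_univ, true_and]
  constructor
  · rintro ⟨⟨a, b⟩, c⟩; exact ⟨b, c⟩
  · rintro ⟨b, c⟩
    refine ⟨⟨?_, b⟩, c⟩
    intro hQ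
    by_cases e : Q = X
    · subst e
      exact (hf Y).2 (h.uniq Y.1 Q _ _ hY (hf Y).1 c Y.2 hX)
    · exact hm (h.uniq Q X m l e b hXm hQ hX)

theorem inj (h : PlaneAx I q) (hf : ∀ X, I X.1 (f X) ∧ f X ≠ l) : Function.Injective f := by
  intro X Y e
  by_contra hc
  have hc' : X.1 ≠ Y.1 := fun e => hc (Subtype.ext e)
  exact (hf X).2 (h.uniq X.1 Y.1 _ _ hc' (hf X).1 (e ▸ (hf Y).1) X.2 Y.2)

theorem index_card (h : PlaneAx I q) : (univ : Finset {X // I X l}).card = q + 1 := by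
  rw [card_univ, ← Nat.card_eq_fintype_card, h.cardL l]

theorem sum_r (h : PlaneAx I q) (hf : ∀ X, I X.1 (f X) ∧ f X ≠ l) :
    ∑ Q with ¬ I Q l, r l f Q = (q + 1) * q := by
  simp_rw [r, card_filter]
  rw [sum_comm]
  have : ∀ X : {X // I X l}, (∑ Q with ¬ I Q l, if I Q (f X) then 1 else 0) = q := by
    intro X
    rw [← card_filter, filter_filter, h.affine_card (hf X).2]
  rw [sum_congr rfl (fun X _ => this X), sum_const, h.index_card, smul_eq_mul]

theorem sum_r_sq (h : PlaneAx I q) (hf : ∀ X, I X.1 (f X) ∧ f X ≠ l) :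
    ∑ Q with ¬ I Q l, r l f Q * r l f Q = 2 * ((q + 1) * q) := by
  have h1 : ∀ X Y : {X // I X l}, (∑ Q with ¬ I Q l,
      (if I Q (f X) then 1 else 0) * (if I Q (f Y) then 1 else 0)) = if X = Y then q else 1 := by
    intro X Y
    have hite : ∀ a b : Prop, (if a then 1 else 0) * (if b then 1 else 0)
        = if a ∧ b then 1 else 0 := by
      intro a b; by_cases a <;> by_cases b <;> simp_all
    split_ifs with e
    · subst e
      simp_rw [hite, and_self]
      rw [← card_filter, filter_filter, h.affine_card (hf X).2]
    · simp_rw [hite]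
      rw [← card_filter, filter_filter]
      have := h.meet_affine hf X.2 (hf X).1 (hf X).2 Y (fun e' => e (Subtype.ext e'.symm))
      rw [← this]
      congr 1; ext; simp [and_assoc]
  simp_rw [r, card_filter, sum_mul_sum]
  rw [sum_comm]
  simp_rw [sum_comm (s := univ.filter (fun Q => ¬ I Q l)), h1]
  have h2 : ∀ X : {X // I X l}, (∑ Y, if X = Y then q else 1) = 2 * q := by
    intro X
    rw [← add_sum_erase _ _ (mem_univ X), if_pos rfl,
      sum_congr rfl (g := fun _ => 1) (fun Y hY => if_neg (ne_of_mem_erase hY).symm)]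
    rw [sum_const, card_erase_of_mem (mem_univ X), h.index_card]
    simp; ring
  rw [sum_congr rfl (fun X _ => h2 X), sum_const, h.index_card, smul_eq_mul]
  ring

/-- The key identity. -/
theorem key (h : PlaneAx I q) (hf : ∀ X, I X.1 (f X) ∧ f X ≠ l) :
    (2 : ℤ) * #{Q | ¬ I Q l ∧ 0 < r l f Q} =
      q * (q + 1) + ∑ Q with ¬ I Q l ∧ 0 < r l f Q, ((r l f Q : ℤ) - 1) * (r l f Q - 2) := by
  have e1 : ∑ Q with ¬ I Q l ∧ 0 < r l f Q, (r l f Q : ℤ) = (q + 1) * q := by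
    have := h.sum_r hf
    rw [← filter_filter, sum_filter_of_ne]
    · exact_mod_cast this
    · intro x _ hx; have : r l f x ≠ 0 := by exact_mod_cast hx
      omega
  have e2 : ∑ Q with ¬ I Q l ∧ 0 < r l f Q, (r l f Q : ℤ) * r l f Q = 2 * ((q + 1) * q) := by
    have := h.sum_r_sq hf
    rw [← filter_filter, sum_filter_of_ne]
    · exact_mod_cast this
    · intro x _ hx; have : r l f x ≠ 0 := by
        intro e; simp [e] at hx
      omega
  have e3 : ∀ Q : P, ((r l f Q : ℤ) - 1) * (r l f Q - 2)
      = (r l f Q : ℤ) * r l f Q - 3 * r l f Q + 2 := by intro Q; ring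
  simp_rw [e3]
  rw [sum_add_distrib, sum_sub_distrib, ← mul_sum, e1, e2, sum_const]
  simp only [nsmul_eq_mul]
  ring

theorem term_nonneg (n : ℕ) : 0 ≤ ((n : ℤ) - 1) * (n - 2) := by
  rcases n with _ | _ | n
  · norm_num
  · norm_num
  · push_cast; nlinarith

theorem bound (h : PlaneAx I q) (hf : ∀ X, I X.1 (f X) ∧ f X ≠ l) :
    q * (q + 1) ≤ 2 * #{Q | ¬ I Q l ∧ 0 < r l f Q} := by
  have h1 := h.key hf
  have h2 : 0 ≤ ∑ Q with ¬ I Q l ∧ 0 < r l f Q, ((r l f Q : ℤ) - 1) * (r l f Q - 2) :=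
    sum_nonneg (fun Q _ => term_nonneg _)
  have h3 : ((q * (q + 1) : ℕ) : ℤ) ≤ ((2 * #{Q | ¬ I Q l ∧ 0 < r l f Q} : ℕ) : ℤ) := by
    push_cast; linarith
  exact_mod_cast h3

theorem eq_iff (h : PlaneAx I q) (hf : ∀ X, I X.1 (f X) ∧ f X ≠ l) :
    2 * #{Q | ¬ I Q l ∧ 0 < r l f Q} = q * (q + 1) ↔ ∀ Q, ¬ I Q l → r l f Q ≤ 2 := by
  have h1 := h.key hf
  have h2 : 2 * #{Q | ¬ I Q l ∧ 0 < r l f Q} = q * (q + 1) ↔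
      ∑ Q with ¬ I Q l ∧ 0 < r l f Q, ((r l f Q : ℤ) - 1) * (r l f Q - 2) = 0 := by
    rw [← Nat.cast_inj (R := ℤ), Nat.cast_mul, Nat.cast_mul, Nat.cast_add, Nat.cast_ofNat, Nat.cast_one]
    constructor <;> intro <;> linarith
  rw [h2, sum_eq_zero_iff_of_nonneg (fun Q _ => term_nonneg _)]
  constructor
  · intro h3 Q hQ
    by_contra hc
    have := h3 Q (by simp [hQ]; omega)
    rcases mul_eq_zero.1 this with e | e <;> omega
  · intro h3 Q hQ
    simp only [mem_filter, mem_univ, true_and] at hQ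
    have := h3 Q hQ.1
    have : r l f Q = 1 ∨ r l f Q = 2 := by omega
    rcases this with e | e <;> simp [e]

theorem even_q (h : PlaneAx I q) (hq : 2 < q) (hf : ∀ X, I X.1 (f X) ∧ f X ≠ l)
    (hr : ∀ Q, ¬ I Q l → r l f Q ≤ 2) : Even q := by
  -- every affine point has `r = 0` or `r = 2`
  have h02 : ∀ Q, ¬ I Q l → Even (r l f Q) := by
    have h1 := h.sum_r hf
    have h2 := h.sum_r_sq hf
    have h3 : ∑ Q with ¬ I Q l, r l f Q * r l f Q = ∑ Q with ¬ I Q l, 2 * r l f Q := by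
      rw [← mul_sum, h1, h2]
    have h4 := (sum_eq_sum_iff_of_le (s := univ.filter (fun Q => ¬ I Q l)) (by
      intro Q hQ
      exact Nat.mul_le_mul_right _ (hr Q (by simpa using hQ)))).1 h3
    intro Q hQ
    have h5 := h4 Q (by simpa using hQ)
    rcases Nat.eq_zero_or_pos (r l f Q) with e | e
    · simp [e]
    · rw [Nat.eq_of_mul_eq_mul_right e h5]; exact even_two
  -- choose a line `m`
  have hc := h.index_card (l := l)
  obtain ⟨X, -, Y, -, hXY⟩ := one_lt_card.1 (show 1 < (univ : Finset {X // I X l}).card by omega)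
  have hXY' : X.1 ≠ Y.1 := fun e => hXY (Subtype.ext e)
  have hlt : #{p | I p (f Y) ∧ I p (f X)} < #{p | ¬ I p l ∧ I p (f Y)} := by
    rw [h.inter_card (fun e => hXY (h.inj hf e.symm)), h.affine_card (hf Y).2]; omega
  obtain ⟨Q, hQ1, hQ2⟩ := exists_mem_notMem_of_card_lt_card hlt
  simp only [mem_filter, mem_univ, true_and] at hQ1 hQ2
  have hQX : X.1 ≠ Q := fun e => hQ1.1 (e ▸ X.2)
  obtain ⟨m, hm1, hm2⟩ := h.ln X.1 Q hQX
  have hml : m ≠ l := fun e => hQ1.1 (e ▸ hm2)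
  have hmf : m ≠ f X := fun e => hQ2 ⟨hQ1.2, e ▸ hm2⟩
  have hsum : ∑ Q with ¬ I Q l ∧ I Q m, r l f Q = q := by
    simp_rw [r, card_filter]
    rw [sum_comm, ← add_sum_erase _ _ (mem_univ X)]
    simp_rw [← card_filter, filter_filter]
    have e0 : #{a | (¬ I a l ∧ I a m) ∧ I a (f X)} = 0 := by
      rw [card_eq_zero, filter_eq_empty_iff]
      rintro a - ⟨⟨a1, a2⟩, a3⟩
      exact hmf (h.uniq X.1 a _ _ (fun e => a1 (e ▸ X.2)) hm1 a2 (hf X).1 a3)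
    rw [e0, sum_congr rfl (g := fun _ => 1) (fun Z hZ => h.meet_affine hf X.2 hm1 hml Z
      (fun e => ne_of_mem_erase hZ (Subtype.ext e)))]
    rw [sum_const, card_erase_of_mem (mem_univ X), hc]
    simp
  rw [← hsum]
  exact even_sum _ (fun Q hQ => h02 Q (by simp at hQ; exact hQ.1))

theorem ncard_le (h : PlaneAx I q) (hf : ∀ X, I X.1 (f X) ∧ f X ≠ l) :
    (∀ Q, {m | (m = l ∨ ∃ X, m = f X) ∧ I Q m}.ncard ≤ 2) ↔ ∀ Q, ¬ I Q l → r l f Q ≤ 2 := by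
  have h1 : ∀ Q, ¬ I Q l → {m | (m = l ∨ ∃ X, m = f X) ∧ I Q m}.ncard = r l f Q := by
    intro Q hQ
    have : {m | (m = l ∨ ∃ X, m = f X) ∧ I Q m}
        = f '' ((univ.filter (fun X => I Q (f X)) : Finset _) : Set {X // I X l}) := by
      ext m
      simp only [Set.mem_ofPred_eq, Set.mem_image, coe_filter, mem_univ, true_and]
      constructor
      · rintro ⟨rfl | ⟨X, rfl⟩, h2⟩
        · exact (hQ h2).elim
        · exact ⟨X, h2, rfl⟩
      · rintro ⟨X, h2, rfl⟩
        exact ⟨Or.inr ⟨X, rfl⟩, h2⟩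
    rw [this, Set.ncard_image_of_injective _ (h.inj hf), Set.ncard_coe_finset, r]
  constructor
  · intro h2 Q hQ
    rw [← h1 Q hQ]; exact h2 Q
  · intro h2 Q
    by_cases hQ : I Q l
    · refine (Set.ncard_le_ncard (t := {l, f ⟨Q, hQ⟩}) ?_ (by simp)).trans ((Set.ncard_insert_le _ _).trans (by simp))
      rintro m ⟨rfl | ⟨X, rfl⟩, h3⟩
      · simp
      · right
        by_cases e : X.1 = Q
        · subst e; rfl
        · exact ((hf X).2 (h.uniq X.1 Q _ _ e (hf X).1 h3 X.2 hQ)).elim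
    · rw [h1 Q hQ]; exact h2 Q hQ

end count

/-- The main structural dichotomy. -/
theorem dichotomy (h : PlaneAx I q) (hq : 2 < q) (S : Set P)
    (hS : ∀ B : Set P, (∀ l : L, ∃ p ∈ B, I p l) → (∀ l, ¬ {p | I p l} ⊆ B) → (S ∩ B).Nonempty)
    (hS2 : ∀ l, ¬ {p | I p l} ⊆ S) :
    (∃ l m : L, l ≠ m ∧ S = {p | ¬ I p l ∧ ¬ I p m}) ∨
    ∃ (l : L) (f : {X // I X l} → L), (∀ X, I X.1 (f X) ∧ f X ≠ l) ∧
      (∀ Q, I Q l → Q ∉ S) ∧ ∀ X Q, I Q (f X) → ¬ I Q l → Q ∈ S := by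
  have hmeet : ∀ l, ∃ p, p ∉ S ∧ I p l := by
    intro l
    obtain ⟨p, hp, hp'⟩ := Set.not_subset.1 (hS2 l)
    exact ⟨p, hp', hp⟩
  have hline : ∃ l, ∀ p, I p l → p ∉ S := by
    by_contra hc
    push Not at hc
    obtain ⟨p, hp, hp'⟩ := hS Sᶜ (fun l => by
      obtain ⟨p, hp, hp'⟩ := hmeet l; exact ⟨p, hp, hp'⟩) (fun l hl => by
      obtain ⟨p, hp, hp'⟩ := hc l
      exact hl hp hp')
    exact hp' hp
  obtain ⟨l, hl⟩ := hline
  by_cases h2 : ∃ m, m ≠ l ∧ ∀ p, I p m → p ∉ S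
  · left
    obtain ⟨m, hml, hm⟩ := h2
    refine ⟨l, m, hml.symm, ?_⟩
    ext R
    simp only [Set.mem_ofPred_eq]
    refine ⟨fun hR => ⟨fun h' => hl R h' hR, fun h' => hm R h' hR⟩, ?_⟩
    rintro ⟨hRl, hRm⟩
    by_contra hRS
    obtain ⟨O, hOl, hOm⟩ := h.pt l m hml.symm
    -- a point of `l` other than `O`
    have hX : ∃ X, I X l ∧ X ≠ O := by
      have : 1 < #{p | I p l} := by rw [h.line_card]; omega
      obtain ⟨X, hX, hne⟩ := exists_mem_ne this O
      exact ⟨X, by simpa using hX, hne⟩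
    obtain ⟨X, hXl, hXO⟩ := hX
    have hXm : ¬ I X m := fun h' => hml (h.uniq X O _ _ hXO h' hOm hXl hOl)
    have hXR : X ≠ R := fun e => hRl (e ▸ hXl)
    obtain ⟨n, hnX, hnR⟩ := h.ln X R hXR
    have hnl : n ≠ l := fun e => hRl (e ▸ hnR)
    have hnm : n ≠ m := fun e => hRm (e ▸ hnR)
    obtain ⟨Y, hYn, hYm⟩ := h.pt n m hnm
    have hXY : X ≠ Y := fun e => hXm (e ▸ hYm)
    have hYl : ¬ I Y l := fun h' => hnl (h.uniq X Y _ _ hXY hnX hYn hXl h')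
    have hYO : Y ≠ O := fun e => hYl (e ▸ hOl)
    have hYR : Y ≠ R := fun e => hRm (e ▸ hYm)
    obtain ⟨p, hpS, hpB⟩ := hS {p | ((I p l ∨ I p m) ∧ p ≠ X ∧ p ≠ Y) ∨ p = R} (by
      intro k
      by_cases hkn : k = n
      · exact ⟨R, Or.inr rfl, hkn ▸ hnR⟩
      by_cases hkl : k = l
      · exact ⟨O, Or.inl ⟨Or.inl hOl, hXO.symm, hYO.symm⟩, hkl ▸ hOl⟩
      by_cases hkm : k = m
      · exact ⟨O, Or.inl ⟨Or.inl hOl, hXO.symm, hYO.symm⟩, hkm ▸ hOm⟩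
      by_cases hkX : I X k
      · obtain ⟨p, hpk, hpm⟩ := h.pt k m hkm
        refine ⟨p, Or.inl ⟨Or.inr hpm, fun e => hXm (e ▸ hpm), ?_⟩, hpk⟩
        rintro rfl
        exact hkn (h.uniq X p _ _ hXY hkX hpk hnX hYn)
      · obtain ⟨p, hpk, hpl⟩ := h.pt k l hkl
        exact ⟨p, Or.inl ⟨Or.inl hpl, fun e => hkX (e ▸ hpk), fun e => hYl (e ▸ hpl)⟩, hpk⟩) (by
      intro k hk
      by_cases hkl : k = l
      · subst hkl
        rcases hk hXl with h' | h'
        · exact h'.2.1 rfl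
        · exact hXR h'
      by_cases hkm : k = m
      · subst hkm
        rcases hk hYm with h' | h'
        · exact h'.2.2 rfl
        · exact hYR h'
      have h5 : (univ.filter (fun p => I p k)) ⊆
          (univ.filter (fun p => I p k ∧ I p l)) ∪ (univ.filter (fun p => I p k ∧ I p m)) ∪ {R} := by
        intro p hp
        simp only [mem_filter, mem_univ, true_and] at hp
        simp only [mem_union, mem_filter, mem_univ, true_and, mem_singleton]
        rcases hk hp with ⟨h' | h', -⟩ | h'
        · exact Or.inl (Or.inl ⟨hp, h'⟩)
        · exact Or.inl (Or.inr ⟨hp, h'⟩)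
        · exact Or.inr h'
      have h6 := (card_le_card h5).trans ((card_union_le _ _).trans
        (Nat.add_le_add_right (card_union_le _ _) _))
      rw [h.line_card, h.inter_card hkl, h.inter_card hkm, card_singleton] at h6
      omega)
    rcases hpB with ⟨h' | h', -⟩ | h'
    · exact hl p h' hpS
    · exact hm p h' hpS
    · exact hRS (h' ▸ hpS)
  · right
    push Not at h2
    refine ⟨l, ?_⟩
    have : ∀ X : {X // I X l}, ∃ m, (I X.1 m ∧ m ≠ l) ∧ ∀ Q, I Q m → ¬ I Q l → Q ∈ S := by
      intro X
      have h3 : ∃ m, ∀ p, p ∉ S → p ≠ X.1 → ¬ I p m := by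
        by_contra hc
        push Not at hc
        obtain ⟨p, hp, hp'⟩ := hS {p | p ∉ S ∧ p ≠ X.1} (fun k => by
          obtain ⟨p, h1, h2, h3⟩ := hc k
          exact ⟨p, ⟨h1, h2⟩, h3⟩) (fun k hk => by
          by_cases hkl : k = l
          · exact (hk (show I X.1 k from hkl ▸ X.2)).2 rfl
          · obtain ⟨p, hp, hp'⟩ := h2 k hkl
            exact (hk hp).1 hp')
        exact hp'.1 hp
      obtain ⟨m, hm⟩ := h3
      have hXm : I X.1 m := by
        obtain ⟨p, hp, hp'⟩ := hmeet m
        by_contra hc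
        exact hm p hp (fun e => hc (e ▸ hp')) hp'
      refine ⟨m, ⟨hXm, ?_⟩, ?_⟩
      · rintro rfl
        have : 1 < #{p | I p m} := by rw [h.line_card]; omega
        obtain ⟨Y, hY, hne⟩ := exists_mem_ne this X.1
        have hY' : I Y m := by simpa using hY
        exact hm Y (hl Y hY') hne hY'
      · intro Q hQm hQl
        by_contra hQS
        exact hm Q hQS (fun e => hQl (e ▸ X.2)) hQm
    choose f hf using this
    exact ⟨f, fun X => (hf X).1, hl, fun X => (hf X).2⟩

theorem union_eq {l : L} {f : {X // I X l} → L} :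
    ((univ.filter (fun Q => ¬ I Q l ∧ 0 < r l f Q) : Finset P) : Set P)
      = {Q | (∃ X, I Q (f X)) ∧ ¬ I Q l} := by
  ext Q
  simp only [coe_filter, mem_univ, true_and, Set.mem_ofPred_eq, r, card_pos, Finset.Nonempty,
    mem_filter]
  tauto

/-- Abstract version of the theorem. -/
theorem main (h : PlaneAx I q) (hq : 2 < q) (S : Set P)
    (hS : ∀ B : Set P, (∀ l : L, ∃ p ∈ B, I p l) → (∀ l, ¬ {p | I p l} ⊆ B) → (S ∩ B).Nonempty)
    (hS2 : ∀ l, ¬ {p | I p l} ⊆ S) :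
    q * (q + 1) ≤ 2 * S.ncard ∧ (2 * S.ncard = q * (q + 1) ↔
      (Even q ∧ ∃ (l : L) (f : {X // I X l} → L), (∀ X, I X.1 (f X) ∧ f X ≠ l) ∧
        (∀ Q, {m | (m = l ∨ ∃ X, m = f X) ∧ I Q m}.ncard ≤ 2) ∧
        S = {Q | (∃ X, I Q (f X)) ∧ ¬ I Q l}) ∨
      (q = 3 ∧ ∃ l m : L, l ≠ m ∧ S = {p | ¬ I p l ∧ ¬ I p m})) := by
  have hc2 : ∀ l m : L, l ≠ m → S = {p | ¬ I p l ∧ ¬ I p m} → S.ncard + q = q ^ 2 := by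
    rintro l m hne rfl
    rw [← h.compl_card hne, ← Set.ncard_coe_finset]
    simp
  have back : ((Even q ∧ ∃ (l : L) (f : {X // I X l} → L), (∀ X, I X.1 (f X) ∧ f X ≠ l) ∧
        (∀ Q, {m | (m = l ∨ ∃ X, m = f X) ∧ I Q m}.ncard ≤ 2) ∧
        S = {Q | (∃ X, I Q (f X)) ∧ ¬ I Q l}) ∨
      (q = 3 ∧ ∃ l m : L, l ≠ m ∧ S = {p | ¬ I p l ∧ ¬ I p m})) →
      2 * S.ncard = q * (q + 1) := by
    rintro (⟨-, l, f, hf, h1, h2⟩ | ⟨h3, l, m, hne, h2⟩)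
    · rw [h2, ← union_eq, Set.ncard_coe_finset]
      exact (h.eq_iff hf).2 ((h.ncard_le hf).1 h1)
    · have := hc2 l m hne h2
      subst h3; omega
  rcases h.dichotomy hq S hS hS2 with ⟨l, m, hne, h2⟩ | ⟨l, f, hf, hl, hfS⟩
  · have h3 := hc2 l m hne h2
    refine ⟨by nlinarith, fun h4 => Or.inr ⟨by nlinarith, l, m, hne, h2⟩, back⟩
  · have hsub : {Q | (∃ X, I Q (f X)) ∧ ¬ I Q l} ⊆ S := by
      rintro Q ⟨⟨X, hX⟩, hQ⟩
      exact hfS X Q hX hQ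
    have hle := Set.ncard_le_ncard hsub (Set.toFinite _)
    have hb := h.bound hf
    rw [← Set.ncard_coe_finset, union_eq] at hb
    refine ⟨by omega, fun h4 => Or.inl ?_, back⟩
    have hSe := Set.eq_of_subset_of_ncard_le hsub (by omega) (Set.toFinite _)
    have hr := (h.eq_iff hf).1 (by
      rw [← Set.ncard_coe_finset, union_eq, hSe]; exact h4)
    exact ⟨h.even_q hq hf hr, l, f, hf, (h.ncard_le hf).2 hr, hSe.symm⟩

end PlaneAx

section concrete
open Module
variable {F : Type*} [Field F]

theorem proj_sup_finrank {p r : ProjPoint F} (hne : p ≠ r) : finrank F ↥(p.1 ⊔ r.1) = 2 := by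
  have h1 := Submodule.finrank_sup_add_finrank_inf_eq p.1 r.1
  rw [p.2, r.2] at h1
  have h2 : finrank F ↥(p.1 ⊓ r.1) = 0 := by
    by_contra hc
    have h3 : p.1 ⊓ r.1 = p.1 := Submodule.eq_of_le_of_finrank_le inf_le_left (by rw [p.2]; omega)
    have h4 : p.1 ⊓ r.1 = r.1 := Submodule.eq_of_le_of_finrank_le inf_le_right (by rw [r.2]; omega)
    exact hne (Subtype.ext (h3.symm.trans h4))
  omega

theorem proj_inf_finrank {l m : ProjLine F} (hne : l ≠ m) : finrank F ↥(l.1 ⊓ m.1) = 1 := by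
  have h1 := Submodule.finrank_sup_add_finrank_inf_eq l.1 m.1
  have h0 := Submodule.finrank_le (l.1 ⊔ m.1)
  rw [finrank_fin_fun] at h0
  rw [l.2, m.2] at h1
  have h2 : ¬ 2 ≤ finrank F ↥(l.1 ⊓ m.1) := by
    intro hc
    have h3 : l.1 ⊓ m.1 = l.1 := Submodule.eq_of_le_of_finrank_le inf_le_left (by rw [l.2]; omega)
    have h4 : l.1 ⊓ m.1 = m.1 := Submodule.eq_of_le_of_finrank_le inf_le_right (by rw [m.2]; omega)
    exact hne (Subtype.ext (h3.symm.trans h4))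
  omega

/-- Points on a line correspond to points of the projectivization of the 2-dimensional space. -/
noncomputable def lineEquiv (l : ProjLine F) :
    {p : ProjPoint F // p.1 ≤ l.1} ≃ {H : Submodule F l.1 // finrank F H = 1} where
  toFun p := ⟨p.1.1.comap l.1.subtype, by
    rw [(Submodule.comapSubtypeEquivOfLe p.2).finrank_eq]; exact p.1.2⟩
  invFun H := ⟨⟨H.1.map l.1.subtype, by
    rw [Submodule.finrank_map_subtype_eq]; exact H.2⟩, Submodule.map_subtype_le _ _⟩
  left_inv p := by
    apply Subtype.ext; apply Subtype.ext
    simp [Submodule.map_comap_subtype, p.2]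
  right_inv H := by
    apply Subtype.ext
    exact Submodule.comap_map_eq_of_injective l.1.injective_subtype _

noncomputable instance projPointFintype [Fintype F] : Fintype (ProjPoint F) := Fintype.ofFinite _

theorem planeAx_proj [Fintype F] (q : ℕ) (hq : Fintype.card F = q) :
    PlaneAx (fun (p : ProjPoint F) (l : ProjLine F) => p.1 ≤ l.1) q where
  pt l m hne := ⟨⟨l.1 ⊓ m.1, proj_inf_finrank hne⟩, inf_le_left, inf_le_right⟩
  ln p r hne := ⟨⟨p.1 ⊔ r.1, proj_sup_finrank hne⟩, le_sup_left, le_sup_right⟩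
  uniq p r l m hne h1 h2 h3 h4 := by
    have e1 : p.1 ⊔ r.1 = l.1 := Submodule.eq_of_le_of_finrank_le (sup_le h1 h2)
      (by rw [l.2, proj_sup_finrank hne])
    have e2 : p.1 ⊔ r.1 = m.1 := Submodule.eq_of_le_of_finrank_le (sup_le h3 h4)
      (by rw [m.2, proj_sup_finrank hne])
    exact Subtype.ext (e1.symm.trans e2)
  cardL l := by
    rw [Nat.card_congr (lineEquiv l), ← Nat.card_congr (Projectivization.equivSubmodule F l.1),
      Projectivization.card_of_finrank_two F l.1 l.2, Nat.card_eq_fintype_card, hq]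
  cardP := by
    rw [← Nat.card_eq_fintype_card, ← Nat.card_congr (Projectivization.equivSubmodule F (Fin 3 → F)),
      Projectivization.card_of_finrank F (Fin 3 → F) (n := 3) (by simp), Nat.card_eq_fintype_card, hq]
    simp [Finset.sum_range_succ]; ring

end concrete

/-- **Cameron–Mazzocca–Meshulam.** Every dual blocking set `S` in `PG(2,q)`,
`q > 2`, satisfies `|S| ≥ q(q+1)/2` (i.e. `2|S| ≥ q(q+1)`), with equality iff
either (i) `q` is even and `S = (⋃_{P ∈ ℓ} ℓ_P) \ ℓ` where the `q+2` lines
`{ℓ} ∪ {ℓ_P : P ∈ ℓ}` form a dual hyperoval (no three concurrent) with `ℓ_P`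
the second line of the hyperoval through `P ∈ ℓ`, or (ii) `q = 3` and `S` is
the complement of the union of two distinct lines. -/
theorem dual_blocking_set_bound_and_equality {F : Type*} [Field F] [Fintype F]
    (q : ℕ) (hq : Fintype.card F = q) (hq2 : 2 < q)
    (S : Set (ProjPoint F)) (hS : IsDualBlockingSet S) :
    q * (q + 1) ≤ 2 * S.ncard ∧
    (2 * S.ncard = q * (q + 1) ↔
      (Even q ∧ ∃ (ℓ : ProjLine F) (f : ∀ P : ProjPoint F, P.1 ≤ ℓ.1 → ProjLine F),
        (∀ (P : ProjPoint F) (h : P.1 ≤ ℓ.1), P.1 ≤ (f P h).1 ∧ f P h ≠ ℓ) ∧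
        (∀ Q : ProjPoint F,
          {m : ProjLine F |
            (m = ℓ ∨ ∃ (P : ProjPoint F) (h : P.1 ≤ ℓ.1), m = f P h) ∧ Q.1 ≤ m.1}.ncard ≤ 2) ∧
        S = {Q : ProjPoint F | (∃ (P : ProjPoint F) (h : P.1 ≤ ℓ.1), Q.1 ≤ (f P h).1)
          ∧ ¬ Q.1 ≤ ℓ.1}) ∨
      (q = 3 ∧ ∃ ℓ m : ProjLine F, ℓ ≠ m ∧
        S = {P : ProjPoint F | ¬ P.1 ≤ ℓ.1 ∧ ¬ P.1 ≤ m.1})) := by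
  have hm := (planeAx_proj q hq).main hq2 S (fun B h1 h2 => hS.1 B ⟨h1, h2⟩) hS.2
  refine ⟨hm.1, hm.2.trans (or_congr_left (and_congr_right fun _ => exists_congr fun ℓ => ?_))⟩
  constructor
  · rintro ⟨f, h1, h2, h3⟩
    refine ⟨fun P h => f ⟨P, h⟩, fun P h => h1 ⟨P, h⟩, fun Q => ?_, ?_⟩
    · simpa only [Subtype.exists] using h2 Q
    · simpa only [Subtype.exists] using h3
  · rintro ⟨f, h1, h2, h3⟩
    refine ⟨fun X => f X.1 X.2, fun X => h1 X.1 X.2, fun Q => ?_, ?_⟩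
    · simpa only [Subtype.exists] using h2 Q
    · simpa only [Subtype.exists] using h3
end

section
/- Let q be a prime power, F = GF(q), and n ≥ 2. Every Besicovitch (Kakeya) set K in AG(n,q) = Fⁿ satisfies |K| ≥ C(q+n−2, n−1) (the binomial coefficient), and in particular |K| ≥ q^{n−1}/(n−1)!. -/
lemma kak_natDegree_prod {F : Type*} [Field F] {n : ℕ} (x v : Fin n → F) (m : Fin n → ℕ)
    (s : Finset (Fin n)) :
    (∏ i ∈ s, (Polynomial.C (v i) * Polynomial.X + Polynomial.C (x i)) ^ m i).natDegree
        ≤ ∑ i ∈ s, m i ∧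
    (∏ i ∈ s, (Polynomial.C (v i) * Polynomial.X + Polynomial.C (x i)) ^ m i).coeff
        (∑ i ∈ s, m i) = ∏ i ∈ s, v i ^ m i := by
  classical
  induction s using Finset.induction_on with
  | empty => simp
  | insert a s ha ih =>
    have h1 : (Polynomial.C (v a) * Polynomial.X + Polynomial.C (x a)).natDegree ≤ 1 :=
      Polynomial.natDegree_linear_le
    have h2 := Polynomial.natDegree_pow_le_of_le (m a) h1
    have h3 := Polynomial.coeff_pow_of_natDegree_le (m := m a) h1
    rw [mul_one] at h2 h3
    rw [Finset.prod_insert ha, Finset.sum_insert ha, Finset.prod_insert ha]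
    refine ⟨Polynomial.natDegree_mul_le_of_le h2 ih.1, ?_⟩
    rw [Polynomial.coeff_mul_add_eq_of_natDegree_le h2 ih.1, ih.2, h3]
    simp

lemma kak_vanish {F : Type*} [Field F] [Fintype F] {n : ℕ}
    (A : Finset (Fin n →₀ ℕ)) (hA : ∀ m ∈ A, ∑ i, m i = Fintype.card F - 1)
    (c : (Fin n →₀ ℕ) → F) (x v : Fin n → F)
    (h : ∀ t : F, ∑ m ∈ A, c m * ∏ i, (x i + t * v i) ^ m i = 0) :
    ∑ m ∈ A, c m * ∏ i, v i ^ m i = 0 := by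
  have hc : 0 < Fintype.card F := Fintype.card_pos
  let f : Polynomial F := ∑ m ∈ A, Polynomial.C (c m) *
    ∏ i, (Polynomial.C (v i) * Polynomial.X + Polynomial.C (x i)) ^ m i
  have hd : f.natDegree ≤ Fintype.card F - 1 := by
    refine Polynomial.natDegree_sum_le_of_forall_le _ _ fun m hm => ?_
    refine (Polynomial.natDegree_C_mul_le _ _).trans ?_
    rw [← hA m hm]
    exact (kak_natDegree_prod x v m Finset.univ).1
  have hf : f = 0 := by
    refine Polynomial.eq_zero_of_natDegree_lt_card_of_eval_eq_zero' f Finset.univ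
      (fun t _ => ?_) (by rw [Finset.card_univ]; omega)
    rw [← h t]
    simp only [f, Polynomial.eval_finsetSum, Polynomial.eval_mul, Polynomial.eval_C,
      Polynomial.eval_prod, Polynomial.eval_pow, Polynomial.eval_add, Polynomial.eval_X]
    refine Finset.sum_congr rfl fun m _ => ?_
    congr 1
    refine Finset.prod_congr rfl fun i _ => ?_
    congr 1
    ring
  have hco : f.coeff (Fintype.card F - 1) = 0 := by rw [hf]; simp
  rw [← hco]
  simp only [f, Polynomial.finsetSum_coeff, Polynomial.coeff_C_mul]
  refine Finset.sum_congr rfl fun m hm => ?_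
  rw [← hA m hm, (kak_natDegree_prod x v m Finset.univ).2]

lemma kak_choose_le {F : Type*} [Field F] [Fintype F] {n : ℕ}
    (K : Set (Fin n → F))
    (hK : ∀ v : Fin n → F, v ≠ 0 → ∃ x : Fin n → F, ∀ t : F, x + t • v ∈ K) :
    (n + (Fintype.card F - 1) - 1).choose (Fintype.card F - 1) ≤ K.ncard := by
  classical
  have hc : 1 < Fintype.card F := Fintype.one_lt_card
  let A : Finset (Fin n →₀ ℕ) := Finset.univ.finsuppAntidiag (Fintype.card F - 1)
  have hA : ∀ m ∈ A, ∑ i, m i = Fintype.card F - 1 := fun m hm =>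
    (Finset.mem_finsuppAntidiag.1 hm).1
  have hAc : A.card = (n + (Fintype.card F - 1) - 1).choose (Fintype.card F - 1) := by
    simpa using Finset.card_finsuppAntidiag_nat_eq_choose (s := (Finset.univ : Finset (Fin n)))
      (Fintype.card F - 1)
  rw [← hAc]
  let L : (A → F) →ₗ[F] (K → F) :=
    { toFun := fun c y => ∑ m : A, c m * ∏ i, (y.1 i) ^ (m.1 i)
      map_add' := by
        intro a b; ext y
        simp [add_mul, Finset.sum_add_distrib]
      map_smul' := by
        intro a b; ext y
        simp [Finset.mul_sum, mul_assoc] }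
  have hL : Function.Injective L := by
    rw [injective_iff_map_eq_zero]
    intro c hcz
    let c' : (Fin n →₀ ℕ) → F := fun m => if h : m ∈ A then c ⟨m, h⟩ else 0
    have hsum : ∀ y : Fin n → F, ∑ m ∈ A, c' m * ∏ i, y i ^ m i
        = ∑ m : A, c m * ∏ i, (y i) ^ (m.1 i) := by
      intro y
      rw [← Finset.sum_coe_sort A]
      refine Finset.sum_congr rfl fun m _ => ?_
      simp [c']
    have hyK : ∀ y ∈ K, ∑ m ∈ A, c' m * ∏ i, y i ^ m i = 0 := fun y hy => by
      rw [hsum]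
      exact congrFun hcz ⟨y, hy⟩
    have hall : ∀ v : Fin n → F, ∑ m ∈ A, c' m * ∏ i, v i ^ m i = 0 := by
      intro v
      by_cases hv : v = 0
      · subst hv
        refine Finset.sum_eq_zero fun m hm => ?_
        have : ∏ i, (0 : Fin n → F) i ^ m i = 0 := by
          simp only [Pi.zero_apply]
          rw [Finset.prod_pow_eq_pow_sum, hA m hm, zero_pow (by omega)]
        rw [this, mul_zero]
      · obtain ⟨x, hx⟩ := hK v hv
        refine kak_vanish A hA c' x v fun t => ?_
        simpa using hyK _ (hx t)
    let P : MvPolynomial (Fin n) F := ∑ m ∈ A, MvPolynomial.monomial m (c' m)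
    have hPc : ∀ m ∈ A, P.coeff m = c' m := by
      intro m hm
      simp [P, MvPolynomial.coeff_sum, MvPolynomial.coeff_monomial, hm]
    have hP : P = 0 := by
      refine MvPolynomial.eq_zero_of_eval_zero_at_prod_finset P (fun _ => Finset.univ)
        (fun i => ?_) (fun v _ => ?_)
      · rw [Finset.card_univ, MvPolynomial.degreeOf_lt_iff (by omega)]
        intro s hs
        have hsA : s ∈ A := by
          by_contra hn
          refine MvPolynomial.mem_support_iff.1 hs ?_
          simp [P, MvPolynomial.coeff_sum, MvPolynomial.coeff_monomial, hn]
        have h1 := Finset.single_le_sum (f := fun i => s i) (fun _ _ => Nat.zero_le _)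
          (Finset.mem_univ i)
        have h2 := hA s hsA
        omega
      · rw [← hall v]
        simp only [P, map_sum, MvPolynomial.eval_monomial]
        refine Finset.sum_congr rfl fun m _ => ?_
        rw [Finsupp.prod_fintype _ _ (by simp)]
    ext m
    have := hPc m.1 m.2
    rw [hP] at this
    simpa [c'] using this.symm
  have := LinearMap.finrank_le_finrank_of_injective hL
  rw [Module.finrank_fintype_fun_eq_card, Module.finrank_fintype_fun_eq_card,
    Fintype.card_coe, ← Nat.card_eq_fintype_card, Nat.card_coe_set_eq] at this
  exact this


/-- **Blokhuis–Mazzocca / Dvir-type bound.** Let `F = GF(q)` and `n ≥ 2`. Every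
Besicovitch (Kakeya) set `K ⊆ Fⁿ` — a set containing a line in every direction —
satisfies `|K| ≥ C(q+n-2, n-1)`, and in particular `|K| ≥ q^(n-1)/(n-1)!`. -/
theorem kakeya_higher_dim_bound {F : Type*} [Field F] [Fintype F]
    (q n : ℕ) (hq : Fintype.card F = q) (hn : 2 ≤ n)
    (K : Set (Fin n → F))
    (hK : ∀ v : Fin n → F, v ≠ 0 → ∃ x : Fin n → F, ∀ t : F, x + t • v ∈ K) :
    (q + n - 2).choose (n - 1) ≤ K.ncard ∧
      q ^ (n - 1) ≤ (n - 1).factorial * K.ncard := by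

  have hc : 1 < Fintype.card F := Fintype.one_lt_card
  have h := kak_choose_le K hK
  rw [hq] at h hc
  have h1 : (q + n - 2).choose (n - 1) ≤ K.ncard := by
    have e : n + (q - 1) - 1 = (n - 1) + (q - 1) := by omega
    have e2 : q + n - 2 = (n - 1) + (q - 1) := by omega
    rw [e, ← Nat.choose_symm_add] at h
    rwa [e2]
  refine ⟨h1, (Nat.pow_succ_le_ascFactorial q (n - 1)).trans ?_⟩
  rw [Nat.ascFactorial_eq_factorial_mul_choose', show q + (n - 1) - 1 = q + n - 2 by omega]
  exact Nat.mul_le_mul_left _ h1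
end
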